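/- arXiv:2511.21144 — 2 statements merged into one kernel-verified Lean document; each statement's English description precedes it below -/
import Mathlib

section
/- For all integers k ≥ 3 and g ≥ 3, there exists a graph G, repeatable with respect to k and g with levels N_0, N_1, …, N_D, such that f(k,g) = |N_0 ∪ N_1 ∪ … ∪ N_{D−g}| / (D+1−g); in particular, f(k,g) is a rational number. -/
/-- A graph is `k`-regular: every vertex has exactly `k` neighbours. -/
def IsRegular' (k : ℕ) {V : Type*} (G : SimpleGraph V) : Prop :=
  ∀ v : V, (G.neighborSet v).ncard = k

/-- A `(k; g, d)`-graph: a `k`-regular simple graph of girth exactly `g` and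
diameter exactly `d`. -/
def IsKGDGraph (k g d : ℕ) {V : Type*} (G : SimpleGraph V) : Prop :=
  IsRegular' k G ∧ G.egirth = g ∧ G.ediam = d

/-- `f(k,g)`: the infimum of all real `c` for which there is a constant `C` such that
for every sufficiently large `d` there is a `(k; g, d)`-graph with at most `c·d + C`
vertices. -/
noncomputable def fRatio (k g : ℕ) : ℝ :=
  sInf {c : ℝ | ∃ C : ℝ, ∃ d₀ : ℕ, ∀ d : ℕ, d₀ ≤ d →
    ∃ n : ℕ, (n : ℝ) ≤ c * d + C ∧ ∃ G : SimpleGraph (Fin n), IsKGDGraph k g d G}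

/-- `levelSet G N0 i`: the set of vertices whose minimum distance to the set `N0` is
exactly `i`. -/
noncomputable def levelSet {V : Type*} (G : SimpleGraph V) (N0 : Set V) (i : ℕ) : Set V :=
  {v : V | (⨅ u ∈ N0, G.edist u v) = (i : ℕ∞)}

/-- `G`, with levels `N₀, N₁, …, N_D` determined by the vertex subset `N0`,
is repeatable with respect to `k` and `g`. -/
structure IsRepeatable (k g : ℕ) {V : Type*} [Fintype V] (G : SimpleGraph V)
    (N0 : Set V) (D : ℕ) : Prop where
  /-- `N_D` is nonempty -/
  top_nonempty : (levelSet G N0 D).Nonempty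
  /-- `D` is the largest index with `N_D` nonempty -/
  top_largest : ∀ i : ℕ, D < i → levelSet G N0 i = ∅
  /-- (1) `G` has girth at least `g` -/
  girth_ge : (g : ℕ∞) ≤ G.egirth
  /-- (2) every vertex in `N_1 ∪ … ∪ N_{D-1}` has degree `k` -/
  middle_regular : ∀ i : ℕ, 1 ≤ i → i ≤ D - 1 →
    ∀ v ∈ levelSet G N0 i, (G.neighborSet v).ncard = k
  /-- (3) if `k` is even, the sum of the degrees of the vertices in `N_0` is even -/
  parity_first : Even k → Even (∑ᶠ v ∈ levelSet G N0 0, (G.neighborSet v).ncard)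
  /-- (4) if `k` is even, the sum of the degrees of the vertices in `N_D` is even -/
  parity_last : Even k → Even (∑ᶠ v ∈ levelSet G N0 D, (G.neighborSet v).ncard)
  /-- (5) `D + 1 ≥ 2g` -/
  long : 2 * g ≤ D + 1
  /-- (6) there is an isomorphism between the subgraphs induced on
  `N_0 ∪ … ∪ N_{g-1}` and on `N_{D-g+1} ∪ … ∪ N_D` mapping, for each `0 ≤ ℓ ≤ g-1`,
  every vertex of `N_ℓ` to a vertex of `N_{ℓ+D-g+1}` -/
  iso : ∃ φ : SimpleGraph.induce (⋃ ℓ ∈ Finset.range g, levelSet G N0 ℓ) G ≃g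
      SimpleGraph.induce (⋃ ℓ ∈ Finset.range g, levelSet G N0 (ℓ + (D + 1 - g))) G,
    ∀ (x : (⋃ ℓ ∈ Finset.range g, levelSet G N0 ℓ : Set V)) (ℓ : ℕ), ℓ < g →
      (x : V) ∈ levelSet G N0 ℓ → ((φ x : V) ∈ levelSet G N0 (ℓ + (D + 1 - g)))

open SimpleGraph

section Girth

variable {V W : Type*}

/-- A short closed walk through an edge that avoids the edge itself bounds the girth. -/
theorem le_length_of_walk_deleteEdges {G : SimpleGraph V} {g : ℕ} (h : (g : ℕ∞) ≤ G.egirth)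
    {u v : V} (huv : G.Adj u v) (w : (G.deleteEdges {s(u, v)}).Walk v u) : g ≤ w.length + 1 := by
  classical
  have hle : G.deleteEdges {s(u, v)} ≤ G := deleteEdges_le _
  let p := w.bypass.mapLe hle
  have hp : p.IsPath := (w.bypass_isPath).mapLe hle
  have hc : (Walk.cons huv p).IsCycle := by
    rw [Walk.cons_isCycle_iff]
    refine ⟨hp, fun he => ?_⟩
    rw [Walk.edges_mapLe_eq_edges] at he
    have := Walk.edges_subset_edgeSet _ he
    simp [edgeSet_deleteEdges] at this
  have := le_egirth.1 h _ _ hc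
  have hl : p.length ≤ w.length := by
    simpa [p, Walk.length_mapLe] using w.length_bypass_le_length
  have h2 : g ≤ p.length + 1 := by
    simpa using (by exact_mod_cast this : g ≤ (Walk.cons huv p).length)
  omega

theorem le_egirth_of_walk_deleteEdges {G : SimpleGraph V} {g : ℕ}
    (h : ∀ u v, G.Adj u v → ∀ w : (G.deleteEdges {s(u, v)}).Walk v u, g ≤ w.length + 1) :
    (g : ℕ∞) ≤ G.egirth := by
  rw [le_egirth]
  intro a w hw
  cases w with
  | nil => simp at hw
  | cons huv p =>
    rw [Walk.cons_isCycle_iff] at hw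
    have := h _ _ huv (p.toDeleteEdges _ (by
      intro e he hs
      simp at hs
      subst hs
      exact hw.2 he))
    simp at this
    exact_mod_cast (by simpa using this : g ≤ (Walk.cons huv p).length)

/-- Cycles that can be mapped injectively into `H` bound the girth of `H`. -/
theorem le_length_of_injOn {G : SimpleGraph V} {H : SimpleGraph W} {g : ℕ}
    (hH : (g : ℕ∞) ≤ H.egirth) {a : V} (c : G.Walk a a) (hc : c.IsCycle) (f : V → W)
    (hf : Set.InjOn f {x | x ∈ c.support})
    (hadj : ∀ x ∈ c.support, ∀ y ∈ c.support, G.Adj x y → H.Adj (f x) (f y)) :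
    g ≤ c.length := by
  cases c with
  | nil => simp at hc
  | @cons _ b _ huv p =>
    rw [Walk.cons_isCycle_iff] at hc
    have key : ∀ {x y : V} (q : G.Walk x y), (∀ z ∈ q.support, z ∈ (Walk.cons huv p).support) →
        s(a, b) ∉ q.edges →
        ∃ q' : (H.deleteEdges {s(f a, f b)}).Walk (f x) (f y), q'.length = q.length := by
      intro x y q
      induction q with
      | nil => exact fun _ _ => ⟨Walk.nil, rfl⟩
      | @cons x y z hxy q ih =>
        intro hs he
        simp only [Walk.edges_cons, List.mem_cons, not_or] at he
        obtain ⟨q', hq'⟩ := ih (fun z hz => hs z (by simp [hz])) he.2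
        have hx := hs x (by simp)
        have hy := hs y (by simp)
        have ha : a ∈ (Walk.cons huv p).support := by simp
        have hb : b ∈ (Walk.cons huv p).support := by simp
        have hA : (H.deleteEdges {s(f a, f b)}).Adj (f x) (f y) := by
          rw [deleteEdges_adj]
          refine ⟨hadj x hx y hy hxy, fun hh => he.1 ?_⟩
          simp only [Set.mem_singleton_iff, Sym2.eq_iff] at hh
          rcases hh with ⟨h1, h2⟩ | ⟨h1, h2⟩
          · rw [hf hx ha h1, hf hy hb h2]
          · rw [hf hx hb h1, hf hy ha h2, Sym2.eq_swap]
        exact ⟨Walk.cons hA q', by simp [hq']⟩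
    obtain ⟨q, hq⟩ := key p (fun z hz => by simp [hz]) hc.2
    have := le_length_of_walk_deleteEdges hH
      (hadj a (by simp) b (by simp) huv) q
    simp only [Walk.length_cons]
    omega

theorem le_egirth_of_injOn {G : SimpleGraph V} {H : SimpleGraph W} {g : ℕ}
    (hH : (g : ℕ∞) ≤ H.egirth)
    (h : ∀ (a : V) (c : G.Walk a a), c.IsCycle → c.length < g → ∃ f : V → W,
      Set.InjOn f {x | x ∈ c.support} ∧
      ∀ x ∈ c.support, ∀ y ∈ c.support, G.Adj x y → H.Adj (f x) (f y)) :
    (g : ℕ∞) ≤ G.egirth := by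
  rw [le_egirth]
  intro a c hc
  by_contra hlt
  have hlt' : c.length < g := by exact_mod_cast not_le.1 hlt
  obtain ⟨f, hf, hadj⟩ := h a c hc hlt'
  have := le_length_of_injOn hH c hc f hf hadj
  omega

theorem le_egirth_comap {G : SimpleGraph V} {g : ℕ} (h : (g : ℕ∞) ≤ G.egirth) {f : W → V}
    (hf : Function.Injective f) : (g : ℕ∞) ≤ (G.comap f).egirth :=
  le_egirth_of_injOn h fun _ _ _ _ => ⟨f, hf.injOn, fun _ _ _ _ h => h⟩

theorem le_egirth_map {G : SimpleGraph V} {g : ℕ} (h : (g : ℕ∞) ≤ G.egirth) (f : V ↪ W) :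
    (g : ℕ∞) ≤ (G.map f).egirth := by
  classical
  refine le_egirth_of_injOn h fun a c hc _ => ?_
  have hV : Nonempty V := by
    cases c with
    | nil => simp at hc
    | cons huv p =>
      obtain ⟨x, _, -⟩ := (SimpleGraph.map_adj _ _ _ _).1 huv
      exact ⟨x⟩
  have hr : ∀ x ∈ c.support, ∃ v, f v = x := by
    intro x hx
    obtain ⟨e, he, hxe⟩ := (Walk.mem_support_iff_exists_mem_edges_of_not_nil hc.not_nil).1 hx
    obtain ⟨y, rfl⟩ := Sym2.mem_iff_exists.1 hxe
    have := Walk.adj_of_mem_edges _ he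
    obtain ⟨x', _, _, h1, _⟩ := (SimpleGraph.map_adj _ _ _ _).1 this
    exact ⟨x', h1⟩
  refine ⟨Function.invFun f, ?_, ?_⟩
  · intro x hx y hy hxy
    obtain ⟨x', rfl⟩ := hr x hx
    obtain ⟨y', rfl⟩ := hr y hy
    rw [Function.leftInverse_invFun f.injective, Function.leftInverse_invFun f.injective] at hxy
    rw [hxy]
  · intro x hx y hy hxy
    obtain ⟨x', rfl⟩ := hr x hx
    obtain ⟨y', rfl⟩ := hr y hy
    rw [Function.leftInverse_invFun f.injective, Function.leftInverse_invFun f.injective]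
    simpa using hxy

/-- A walk in `G ⊔ edge s t` either gives a walk in `G`, or passes through the edge. -/
theorem exists_walk_of_sup_edge {G : SimpleGraph V} {s t : V} {a b : V}
    (w : (G ⊔ edge s t).Walk a b) :
    (∃ p : G.Walk a b, p.length ≤ w.length) ∨
    (∃ (p : G.Walk a s) (q : G.Walk t b), p.length + q.length + 1 ≤ w.length) ∨
    (∃ (p : G.Walk a t) (q : G.Walk s b), p.length + q.length + 1 ≤ w.length) := by
  induction w with
  | nil => exact Or.inl ⟨Walk.nil, le_rfl⟩
  | @cons a a' b h w ih =>
    rw [sup_adj, edge_adj] at h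
    rcases h with h | ⟨⟨rfl, rfl⟩ | ⟨rfl, rfl⟩, hne⟩
    · rcases ih with ⟨p, hp⟩ | ⟨p, q, hpq⟩ | ⟨p, q, hpq⟩
      · exact Or.inl ⟨Walk.cons h p, by simpa using hp⟩
      · exact Or.inr (Or.inl ⟨Walk.cons h p, q, by simp; omega⟩)
      · exact Or.inr (Or.inr ⟨Walk.cons h p, q, by simp; omega⟩)
    · rcases ih with ⟨p, hp⟩ | ⟨p, q, hpq⟩ | ⟨p, q, hpq⟩
      · exact Or.inr (Or.inl ⟨Walk.nil, p, by simpa using hp⟩)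
      · exact Or.inr (Or.inl ⟨Walk.nil, q, by simp; omega⟩)
      · exact Or.inl ⟨q, by simp; omega⟩
    · rcases ih with ⟨p, hp⟩ | ⟨p, q, hpq⟩ | ⟨p, q, hpq⟩
      · exact Or.inr (Or.inr ⟨Walk.nil, p, by simpa using hp⟩)
      · exact Or.inl ⟨q, by simp; omega⟩
      · exact Or.inr (Or.inr ⟨Walk.nil, q, by simp; omega⟩)

theorem le_egirth_sup_edge {G : SimpleGraph V} {g : ℕ} (h : (g : ℕ∞) ≤ G.egirth) {s t : V}
    (hst : ∀ w : G.Walk s t, g ≤ w.length + 1) : (g : ℕ∞) ≤ (G ⊔ edge s t).egirth := by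
  apply le_egirth_of_walk_deleteEdges
  intro u v huv w
  by_cases he : s(u, v) = s(s, t)
  · have hle : (G ⊔ edge s t).deleteEdges {s(u, v)} ≤ G := by
      intro x y hxy
      simp only [deleteEdges_adj, sup_adj, edge_adj, he, Set.mem_singleton_iff, Sym2.eq_iff] at hxy
      tauto
    rcases Sym2.eq_iff.1 he with ⟨rfl, rfl⟩ | ⟨rfl, rfl⟩
    · simpa using hst (w.mapLe hle).reverse
    · simpa using hst (w.mapLe hle)
  · have hG : G.Adj u v := by
      rw [sup_adj, edge_adj] at huv
      rcases huv with h | ⟨h, _⟩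
      · exact h
      · exact absurd (Sym2.eq_iff.2 h) he
    have hle : (G ⊔ edge s t).deleteEdges {s(u, v)} ≤ G.deleteEdges {s(u, v)} ⊔ edge s t := by
      intro x y hxy
      simp only [deleteEdges_adj, sup_adj] at hxy ⊢
      tauto
    have hle2 : G.deleteEdges {s(u, v)} ≤ G := deleteEdges_le _
    rcases exists_walk_of_sup_edge (w.mapLe hle) with ⟨p, hp⟩ | ⟨p, q, hpq⟩ | ⟨p, q, hpq⟩
    · have := le_length_of_walk_deleteEdges h hG p
      simp at hp
      omega
    · have := hst ((p.mapLe hle2).reverse.append (Walk.cons hG.symm (q.mapLe hle2).reverse))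
      simp at this hpq
      omega
    · have := hst ((q.mapLe hle2).append (Walk.cons hG (p.mapLe hle2)))
      simp at this hpq
      omega

theorem add_length_of_lipschitz {G : SimpleGraph V} (f : V → ℕ)
    (hf : ∀ u v, G.Adj u v → f u ≤ f v + 1) {u v : V} (w : G.Walk u v) :
    f u ≤ f v + w.length := by
  induction w with
  | nil => simp
  | cons h p ih =>
    have := hf _ _ h
    simp only [Walk.length_cons]
    omega

end Girth

section Degree

variable {V W : Type*}

theorem ncard_neighborSet_sup_edge [Finite V] [DecidableEq V] {G : SimpleGraph V} {s t : V}
    (hne : s ≠ t) (hst : ¬ G.Adj s t) (v : V) :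
    ((G ⊔ edge s t).neighborSet v).ncard =
      (G.neighborSet v).ncard + (if v = s then 1 else 0) + (if v = t then 1 else 0) := by
  by_cases hs : v = s
  · subst hs
    have : (G ⊔ edge v t).neighborSet v = insert t (G.neighborSet v) := by
      ext x
      simp only [mem_neighborSet, sup_adj, edge_adj, Set.mem_insert_iff]
      constructor
      · rintro (h | ⟨⟨-, rfl⟩ | ⟨h, -⟩, -⟩)
        · exact Or.inr h
        · exact Or.inl rfl
        · exact absurd h hne
      · rintro (rfl | h)
        · exact Or.inr ⟨Or.inl ⟨trivial, rfl⟩, hne⟩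
        · exact Or.inl h
    rw [this, Set.ncard_insert_of_notMem (by simpa using hst) (Set.toFinite _)]
    simp [hne]
  · by_cases ht : v = t
    · subst ht
      have : (G ⊔ edge s v).neighborSet v = insert s (G.neighborSet v) := by
        ext x
        simp only [mem_neighborSet, sup_adj, edge_adj, Set.mem_insert_iff]
        constructor
        · rintro (h | ⟨⟨h, -⟩ | ⟨-, rfl⟩, -⟩)
          · exact Or.inr h
          · exact absurd h hs
          · exact Or.inl rfl
        · rintro (rfl | h)
          · exact Or.inr ⟨Or.inr ⟨trivial, rfl⟩, hs⟩
          · exact Or.inl h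
      rw [this, Set.ncard_insert_of_notMem (by simpa [G.adj_comm] using hst) (Set.toFinite _)]
      simp [hs]
    · have : (G ⊔ edge s t).neighborSet v = G.neighborSet v := by
        ext x
        simp [mem_neighborSet, edge_adj, hs, ht]
      simp [this, hs, ht]

theorem deleteEdges_sup_edge {G : SimpleGraph V} {s t : V} (h : G.Adj s t) :
    G.deleteEdges {s(s, t)} ⊔ edge s t = G := by
  ext x y
  simp only [sup_adj, deleteEdges_adj, edge_adj, Set.mem_singleton_iff, Sym2.eq_iff]
  constructor
  · rintro (h1 | ⟨⟨rfl, rfl⟩ | ⟨rfl, rfl⟩, -⟩)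
    · exact h1.1
    · exact h
    · exact h.symm
  · intro h1
    have := h1.ne
    tauto

theorem ncard_neighborSet_deleteEdges [Finite V] [DecidableEq V] {G : SimpleGraph V} {s t : V}
    (h : G.Adj s t) (v : V) :
    ((G.deleteEdges {s(s, t)}).neighborSet v).ncard + (if v = s then 1 else 0) +
      (if v = t then 1 else 0) = (G.neighborSet v).ncard := by
  rw [← ncard_neighborSet_sup_edge h.ne (by simp), deleteEdges_sup_edge h]

/-- Two graphs `A` and `T` joined by the two edges `x p` and `y q`. -/
def joinTwo (A : SimpleGraph V) (T : SimpleGraph W) (x y : V) (p q : W) : SimpleGraph (V ⊕ W) :=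
  ((A ⊕g T) ⊔ edge (Sum.inl x) (Sum.inr p)) ⊔ edge (Sum.inl y) (Sum.inr q)

variable {A : SimpleGraph V} {T : SimpleGraph W} {x y : V} {p q : W}

@[simp] theorem joinTwo_inl_inl {u v : V} :
    (joinTwo A T x y p q).Adj (Sum.inl u) (Sum.inl v) ↔ A.Adj u v := by
  simp [joinTwo, edge_adj]

@[simp] theorem joinTwo_inr_inr {u v : W} :
    (joinTwo A T x y p q).Adj (Sum.inr u) (Sum.inr v) ↔ T.Adj u v := by
  simp [joinTwo, edge_adj]

@[simp] theorem joinTwo_inl_inr {u : V} {v : W} :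
    (joinTwo A T x y p q).Adj (Sum.inl u) (Sum.inr v) ↔ (u = x ∧ v = p) ∨ (u = y ∧ v = q) := by
  simp [joinTwo, edge_adj]

@[simp] theorem joinTwo_inr_inl {u : V} {v : W} :
    (joinTwo A T x y p q).Adj (Sum.inr v) (Sum.inl u) ↔ (u = x ∧ v = p) ∨ (u = y ∧ v = q) := by
  rw [adj_comm, joinTwo_inl_inr]

theorem ncard_neighborSet_joinTwo_inl [Finite V] [Finite W] [DecidableEq V] (hxy : x ≠ y) (u : V) :
    ((joinTwo A T x y p q).neighborSet (Sum.inl u)).ncard =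
      (A.neighborSet u).ncard + (if u = x then 1 else 0) + (if u = y then 1 else 0) := by
  classical
  rw [joinTwo, ncard_neighborSet_sup_edge (by simp) (by simp [edge_adj, hxy.symm]),
    ncard_neighborSet_sup_edge (by simp) (by simp)]
  have : (A ⊕g T).neighborSet (Sum.inl u) = Sum.inl '' A.neighborSet u := by
    ext z; cases z <;> simp
  rw [this, Set.ncard_image_of_injective _ Sum.inl_injective]
  simp

theorem ncard_neighborSet_joinTwo_inr [Finite V] [Finite W] [DecidableEq W] (hxy : x ≠ y) (w : W) :
    ((joinTwo A T x y p q).neighborSet (Sum.inr w)).ncard =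
      (T.neighborSet w).ncard + (if w = p then 1 else 0) + (if w = q then 1 else 0) := by
  classical
  rw [joinTwo, ncard_neighborSet_sup_edge (by simp) (by simp [edge_adj, hxy.symm]),
    ncard_neighborSet_sup_edge (by simp) (by simp)]
  have : (A ⊕g T).neighborSet (Sum.inr w) = Sum.inr '' T.neighborSet w := by
    ext z; cases z <;> simp
  rw [this, Set.ncard_image_of_injective _ Sum.inr_injective]
  simp

theorem le_egirth_sum {g : ℕ} (hA : (g : ℕ∞) ≤ A.egirth) (hT : (g : ℕ∞) ≤ T.egirth) :
    (g : ℕ∞) ≤ (A ⊕g T).egirth := by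
  have key1 : ∀ {a : V} {b : V ⊕ W} (w : (A ⊕g T).Walk (Sum.inl a) b), ∀ z ∈ w.support,
      ∃ v, z = Sum.inl v := by
    have : ∀ {a b : V ⊕ W} (w : (A ⊕g T).Walk a b), (∃ v, a = Sum.inl v) → ∀ z ∈ w.support,
        ∃ v, z = Sum.inl v := by
      intro a b w
      induction w with
      | nil => rintro ⟨v, rfl⟩ z hz; simp at hz; exact ⟨v, hz⟩
      | @cons a c b h w ih =>
        rintro ⟨v, rfl⟩ z hz
        simp only [Walk.support_cons, List.mem_cons] at hz
        rcases hz with rfl | hz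
        · exact ⟨v, rfl⟩
        · refine ih ?_ z hz
          cases c with
          | inl c => exact ⟨c, rfl⟩
          | inr c => simp at h
    exact fun {a b} w => this w ⟨_, rfl⟩
  have key2 : ∀ {a : W} {b : V ⊕ W} (w : (A ⊕g T).Walk (Sum.inr a) b), ∀ z ∈ w.support,
      ∃ v, z = Sum.inr v := by
    have : ∀ {a b : V ⊕ W} (w : (A ⊕g T).Walk a b), (∃ v, a = Sum.inr v) → ∀ z ∈ w.support,
        ∃ v, z = Sum.inr v := by
      intro a b w
      induction w with
      | nil => rintro ⟨v, rfl⟩ z hz; simp at hz; exact ⟨v, hz⟩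
      | @cons a c b h w ih =>
        rintro ⟨v, rfl⟩ z hz
        simp only [Walk.support_cons, List.mem_cons] at hz
        rcases hz with rfl | hz
        · exact ⟨v, rfl⟩
        · refine ih ?_ z hz
          cases c with
          | inr c => exact ⟨c, rfl⟩
          | inl c => simp at h
    exact fun {a b} w => this w ⟨_, rfl⟩
  rw [le_egirth]
  rintro (a | a) c hc
  · have := le_length_of_injOn hA c hc (fun z => z.elim id (fun _ => a)) ?_ ?_
    · exact_mod_cast this
    · intro u hu v hv huv
      obtain ⟨u, rfl⟩ := key1 c u hu
      obtain ⟨v, rfl⟩ := key1 c v hv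
      simpa using huv
    · intro u hu v hv huv
      obtain ⟨u, rfl⟩ := key1 c u hu
      obtain ⟨v, rfl⟩ := key1 c v hv
      simpa using huv
  · have := le_length_of_injOn hT c hc (fun z => z.elim (fun _ => a) id) ?_ ?_
    · exact_mod_cast this
    · intro u hu v hv huv
      obtain ⟨u, rfl⟩ := key2 c u hu
      obtain ⟨v, rfl⟩ := key2 c v hv
      simpa using huv
    · intro u hu v hv huv
      obtain ⟨u, rfl⟩ := key2 c u hu
      obtain ⟨v, rfl⟩ := key2 c v hv
      simpa using huv

theorem exists_walk_of_walk_sum_sup_edge {u : V} {w : W}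
    (c : ((A ⊕g T) ⊔ edge (Sum.inl x) (Sum.inr p)).Walk (Sum.inl u) (Sum.inr w)) :
    ∃ r : A.Walk x u, r.length + 1 ≤ c.length := by
  have : ∀ {a b : V ⊕ W} (c : ((A ⊕g T) ⊔ edge (Sum.inl x) (Sum.inr p)).Walk a b) (u : V) (w : W),
      a = Sum.inl u → b = Sum.inr w → ∃ r : A.Walk u x, r.length + 1 ≤ c.length := by
    intro a b c
    induction c with
    | nil => rintro u w rfl h; simp at h
    | @cons a a' b h c ih =>
      rintro u w rfl rfl
      cases a' with
      | inl u' =>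
        obtain ⟨r, hr⟩ := ih u' w rfl rfl
        have : A.Adj u u' := by simpa [edge_adj] using h
        exact ⟨Walk.cons this r, by simpa using hr⟩
      | inr w' =>
        have : u = x := by
          have : u = x ∧ w' = p := by simpa [edge_adj] using h
          exact this.1
        subst this
        exact ⟨Walk.nil, by simp⟩
  obtain ⟨r, hr⟩ := this c u w rfl rfl
  exact ⟨r.reverse, by simpa using hr⟩

theorem le_egirth_joinTwo {g : ℕ} (hA : (g : ℕ∞) ≤ A.egirth) (hT : (g : ℕ∞) ≤ T.egirth)
    (h : ∀ w : A.Walk x y, g ≤ w.length + 2) : (g : ℕ∞) ≤ (joinTwo A T x y p q).egirth := by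
  refine le_egirth_sup_edge (le_egirth_sup_edge (le_egirth_sum hA hT) ?_) ?_
  · intro w
    exfalso
    have : ∀ {a b : V ⊕ W} (c : (A ⊕g T).Walk a b), a.isLeft = b.isLeft := by
      intro a b c
      induction c with
      | nil => rfl
      | @cons a a' b h c ih =>
        rw [← ih]
        cases a <;> cases a' <;> simp at h ⊢
    simpa using this w
  · intro w
    obtain ⟨r, hr⟩ := exists_walk_of_walk_sum_sup_edge w
    have := h r
    omega

/-- The inclusion of the first part of a join. -/
def joinTwoInl (A : SimpleGraph V) (T : SimpleGraph W) (x y : V) (p q : W) :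
    A →g joinTwo A T x y p q := ⟨Sum.inl, by simp⟩

/-- The inclusion of the second part of a join. -/
def joinTwoInr (A : SimpleGraph V) (T : SimpleGraph W) (x y : V) (p q : W) :
    T →g joinTwo A T x y p q := ⟨Sum.inr, by simp⟩

theorem egirth_le_of_hom {G : SimpleGraph V} {H : SimpleGraph W} (f : G →g H)
    (hf : Function.Injective f) : H.egirth ≤ G.egirth := by
  rw [le_egirth]
  intro a c hc
  have := egirth_le_length ((Walk.isCycle_map_iff_of_injective hf).2 hc)
  simpa using this

theorem egirth_joinTwo_le_left : (joinTwo A T x y p q).egirth ≤ A.egirth :=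
  egirth_le_of_hom (joinTwoInl A T x y p q) Sum.inl_injective

theorem egirth_joinTwo_le_right : (joinTwo A T x y p q).egirth ≤ T.egirth :=
  egirth_le_of_hom (joinTwoInr A T x y p q) Sum.inr_injective

theorem connected_joinTwo (hT : T.Connected) (hA : ∀ u, A.Reachable u x ∨ A.Reachable u y) :
    (joinTwo A T x y p q).Connected := by
  have hr : ∀ w, (joinTwo A T x y p q).Reachable (Sum.inr w) (Sum.inr p) := fun w =>
    (hT.preconnected w p).map (joinTwoInr A T x y p q)
  have hl : ∀ u, (joinTwo A T x y p q).Reachable (Sum.inl u) (Sum.inr p) := by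
    intro u
    rcases hA u with h | h
    · refine (h.map (joinTwoInl A T x y p q)).trans ?_
      exact Adj.reachable (by simp [joinTwoInl])
    · refine ((h.map (joinTwoInl A T x y p q)).trans ?_).trans (hr q)
      exact Adj.reachable (by simp [joinTwoInl])
  have : ∀ z, (joinTwo A T x y p q).Reachable z (Sum.inr p) := by
    rintro (u | w)
    exacts [hl u, hr w]
  exact (connected_iff _).2 ⟨fun a b => (this a).trans (this b).symm, ⟨Sum.inr p⟩⟩

theorem reachable_deleteEdges_or {G : SimpleGraph V} (hG : G.Connected) (hxy : G.Adj x y) (u : V) :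
    (G.deleteEdges {s(x, y)}).Reachable u x ∨ (G.deleteEdges {s(x, y)}).Reachable u y := by
  obtain ⟨w⟩ := hG.preconnected u x
  have hle : G ≤ G.deleteEdges {s(x, y)} ⊔ edge x y := (deleteEdges_sup_edge hxy).ge
  rcases exists_walk_of_sup_edge (w.mapLe hle) with ⟨p, -⟩ | ⟨p, -, -⟩ | ⟨p, -, -⟩
  · exact Or.inl ⟨p⟩
  · exact Or.inl ⟨p⟩
  · exact Or.inr ⟨p⟩

end Degree

section HighGirth

/-- Words of length at most `r` over `k` letters with no two equal consecutive letters. -/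
abbrev ReducedWord (k r : ℕ) : Type :=
  {l : List (Fin k) // l.IsChain (· ≠ ·) ∧ l.length ≤ r}

variable {k r : ℕ}

instance : Finite (ReducedWord k r) :=
  ((List.finite_length_le (Fin k) r).subset fun _ h => h.2).to_subtype

/-- Delete the first letter `c` of a word, or put `c` in front of it if there is room. -/
def toggleList (r : ℕ) (c : Fin k) (l : List (Fin k)) : List (Fin k) :=
  if l.head? = some c then l.tail else if l.length < r then c :: l else l

theorem toggleList_mem (c : Fin k) {l : List (Fin k)} (hl : l.IsChain (· ≠ ·) ∧ l.length ≤ r) :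
    (toggleList r c l).IsChain (· ≠ ·) ∧ (toggleList r c l).length ≤ r := by
  unfold toggleList
  split_ifs with h1 h2
  · exact ⟨hl.1.tail, by simp; omega⟩
  · refine ⟨List.isChain_cons.2 ⟨fun y hy => ?_, hl.1⟩, by simp; omega⟩
    rintro rfl
    exact h1 (by simpa using hy)
  · exact hl

theorem toggleList_toggleList (c : Fin k) {l : List (Fin k)}
    (hl : l.IsChain (· ≠ ·) ∧ l.length ≤ r) : toggleList r c (toggleList r c l) = l := by
  by_cases h1 : l.head? = some c
  · obtain ⟨t, rfl⟩ : ∃ t, l = c :: t := by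
      cases l with
      | nil => simp at h1
      | cons a t => simp at h1; exact ⟨t, by rw [h1]⟩
    have h2 : t.head? ≠ some c := by
      intro h
      have := (List.isChain_cons.1 hl.1).1 c (by simpa using h)
      exact this rfl
    have h3 : t.length < r := by simpa using hl.2
    simp [toggleList, h2, h3]
  · by_cases h2 : l.length < r
    · simp [toggleList, h1, h2]
    · simp [toggleList, h1, h2]

/-- The involution of the set of reduced words given by `toggleList`. -/
def toggle (c : Fin k) : Equiv.Perm (ReducedWord k r) where
  toFun l := ⟨toggleList r c l.1, toggleList_mem c l.2⟩
  invFun l := ⟨toggleList r c l.1, toggleList_mem c l.2⟩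
  left_inv l := Subtype.ext (toggleList_toggleList c l.2)
  right_inv l := Subtype.ext (toggleList_toggleList c l.2)

theorem toggle_mul_toggle (c : Fin k) : toggle c * toggle c = (1 : Equiv.Perm (ReducedWord k r)) :=
  Equiv.ext fun l => Subtype.ext (toggleList_toggleList c l.2)

theorem toggle_nil (hr : 1 ≤ r) (c : Fin k) :
    (toggle c ⟨[], by simp⟩ : ReducedWord k r).1 = [c] := by
  have : 0 < r := hr
  simp [toggle, toggleList, this]

/-- The Cayley graph generated by the involutions `toggle c`. -/
def toggleGraph (k r : ℕ) (hr : 1 ≤ r) : SimpleGraph (Equiv.Perm (ReducedWord k r)) where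
  Adj a b := ∃ c, b = toggle c * a
  symm := ⟨by
    rintro a b ⟨c, rfl⟩
    exact ⟨c, by rw [← mul_assoc, toggle_mul_toggle, one_mul]⟩⟩
  loopless := ⟨by
    rintro a ⟨c, h⟩
    have h1 : toggle c = (1 : Equiv.Perm (ReducedWord k r)) := by
      simpa using h.symm
    have := toggle_nil hr c
    rw [h1] at this
    simp at this⟩

theorem ncard_neighborSet_toggleGraph (hr : 1 ≤ r) (a : Equiv.Perm (ReducedWord k r)) :
    ((toggleGraph k r hr).neighborSet a).ncard = k := by
  have : (toggleGraph k r hr).neighborSet a = Set.range (fun c : Fin k => toggle c * a) := by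
    ext b
    simp [toggleGraph, eq_comm]
  rw [this, ← Set.image_univ, Set.ncard_image_of_injective, Set.ncard_univ, Nat.card_fin]
  intro c c' h
  have h1 : toggle c = (toggle c' : Equiv.Perm (ReducedWord k r)) := by simpa using h
  have := toggle_nil hr c
  rw [h1, toggle_nil hr c'] at this
  simpa using this.symm

theorem length_of_isTrail_toggleGraph (hr : 1 ≤ r) {a b : Equiv.Perm (ReducedWord k r)}
    (w : (toggleGraph k r hr).Walk a b) (hw : w.IsTrail) :
    ∀ (u : Equiv.Perm (ReducedWord k r)) (c : Fin k) (l : ReducedWord k r), a = toggle c * u →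
      s(u, a) ∉ w.edges → l.1.head? = some c → l.1.length + w.length ≤ r →
      ((b * a⁻¹) l).1.length = l.1.length + w.length := by
  induction w with
  | nil => intros; simp
  | @cons a a' b h w ih =>
    intro u c l ha he hl hlen
    rw [Walk.isTrail_cons] at hw
    have hE : ∃ c, a' = toggle c * a := h
    obtain ⟨c', hc'⟩ := hE
    simp only [Walk.edges_cons, List.mem_cons, not_or, Walk.length_cons] at he hlen ⊢
    have hne : c ≠ c' := by
      rintro rfl
      apply he.1
      rw [hc', ha, ← mul_assoc, toggle_mul_toggle, one_mul, Sym2.eq_swap]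
    have hlt : l.1.length < r := by omega
    have hl' : (toggle c' l).1 = c' :: l.1 := by
      simp [toggle, toggleList, hl, hne, hlt]
    have := ih hw.1 a c' (toggle c' l) hc' hw.2 (by simp [hl']) (by simp [hl']; omega)
    have h2 : (b * a⁻¹) l = (b * a'⁻¹) (toggle c' l) := by
      rw [hc']
      simp [mul_inv_rev]
    rw [h2, this, hl']
    simp
    omega

theorem le_egirth_toggleGraph (hr : 1 ≤ r) : ((r + 1 : ℕ) : ℕ∞) ≤ (toggleGraph k r hr).egirth := by
  rw [le_egirth]
  intro a w hw
  cases w with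
  | nil => simp at hw
  | @cons _ b _ h p =>
    by_contra hlt
    have hlt : p.length + 1 < r + 1 := by
      have := not_le.1 hlt
      rw [Walk.length_cons] at this
      exact_mod_cast this
    rw [Walk.cons_isCycle_iff] at hw
    have hE : ∃ c, b = toggle c * a := h
    obtain ⟨c, hc⟩ := hE
    have hn := toggle_nil hr c
    have := length_of_isTrail_toggleGraph hr p hw.1.isTrail a c (toggle c ⟨[], by simp⟩) hc hw.2
      (by simp [hn]) (by simp [hn]; omega)
    have h2 : (a * b⁻¹) (toggle c ⟨[], by simp⟩) = ⟨[], by simp⟩ := by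
      rw [hc]
      simp [mul_inv_rev]
    rw [h2, hn] at this
    simp only [List.length_nil, List.length_singleton] at this
    omega

end HighGirth

section Existence

variable {V W : Type*} {k : ℕ}

theorem isRegular'_toSimpleGraph {G : SimpleGraph V} (hG : IsRegular' k G)
    (C : G.ConnectedComponent) : IsRegular' k C.toSimpleGraph := by
  rintro ⟨v, hv⟩
  rw [← hG v]
  have : G.neighborSet v = Subtype.val '' (C.toSimpleGraph.neighborSet ⟨v, hv⟩) := by
    ext x
    simp only [mem_neighborSet, Set.mem_image, Subtype.exists, exists_and_right, exists_eq_right]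
    constructor
    · intro h
      exact ⟨C.mem_supp_of_adj_mem_supp hv h, h⟩
    · rintro ⟨_, h⟩
      exact h
  rw [this, Set.ncard_image_of_injective _ Subtype.val_injective]

theorem not_isAcyclic_of_isRegular' [Finite V] {G : SimpleGraph V} (hk : 2 ≤ k)
    (hG : IsRegular' k G) (hc : G.Connected) : ¬ G.IsAcyclic := by
  classical
  intro ha
  have := Fintype.ofFinite V
  have hT : G.IsTree := ⟨hc, ha⟩
  have hd : ∀ v, G.degree v = k := by
    intro v
    rw [← hG v, ← Nat.card_coe_set_eq, Nat.card_eq_fintype_card, card_neighborSet_eq_degree]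
  have : Nontrivial V := by
    obtain ⟨v⟩ := hc.nonempty
    have : 0 < G.degree v := by rw [hd]; omega
    obtain ⟨w, hw⟩ := (G.degree_pos_iff_exists_adj v).1 this
    exact ⟨v, w, hw.ne⟩
  obtain ⟨v, hv⟩ := hT.exists_vert_degree_one_of_nontrivial
  rw [hd] at hv
  omega

theorem exists_egirth_eq_natCast [Finite V] {G : SimpleGraph V} (hk : 2 ≤ k)
    (hG : IsRegular' k G) (hc : G.Connected) : ∃ n : ℕ, G.egirth = n := by
  obtain ⟨a, w, hw, h⟩ := exists_egirth_eq_length.2 (not_isAcyclic_of_isRegular' hk hG hc)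
  exact ⟨w.length, h⟩

theorem egirth_toSimpleGraph_le {G : SimpleGraph V} {a : V} {w : G.Walk a a} (hw : w.IsCycle) :
    (G.connectedComponentMk a).toSimpleGraph.egirth ≤ w.length := by
  have hs : ∀ x ∈ w.support, x ∈ (G.connectedComponentMk a).supp := by
    intro x hx
    classical
    exact ConnectedComponent.sound (w.takeUntil x hx).reachable.symm
  have h1 : (w.induce _ hs).map (Embedding.induce (G := G) _).toHom = w := w.map_induce hs
  have h2 : (w.induce _ hs).IsCycle := by
    refine (Walk.isCycle_map_iff_of_injective (f := (Embedding.induce (G := G) _).toHom)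
      (Embedding.induce (G := G) _).injective).1 ?_
    rwa [h1]
  have h3 : (w.induce _ hs).length = w.length := by
    have := congrArg Walk.length h1
    rwa [Walk.length_map] at this
  rw [← h3]
  exact egirth_le_length h2

theorem exists_regular_egirth_pred [Finite V] {G : SimpleGraph V} {h : ℕ} (hh : 3 ≤ h)
    (hG : IsRegular' k G) (he : G.egirth = ((h + 1 : ℕ) : ℕ∞)) :
    ∃ H : SimpleGraph (V ⊕ V), IsRegular' k H ∧ H.egirth = h := by
  classical
  obtain ⟨v, c, hc, hlen⟩ := (exists_egirth_eq_length (G := G)).2 (by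
    rw [← egirth_eq_top, he]; exact ENat.natCast_ne_top _)
  have hlen : c.length = h + 1 := by rw [he] at hlen; exact_mod_cast hlen.symm
  cases c with
  | nil => simp at hc
  | @cons _ y _ hvy p =>
  rw [Walk.cons_isCycle_iff] at hc
  simp only [Walk.length_cons, Nat.add_right_cancel_iff] at hlen
  have hpn : ¬ p.Nil := by
    intro hn
    have := hn.length_eq_zero
    omega
  obtain ⟨z, q, hzv, rfl⟩ : ∃ (z : V) (q : G.Walk y z) (hzv : G.Adj z v), p = q.concat hzv := by
    refine ⟨_, p.dropLast, p.adj_penultimate hpn, ?_⟩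
    exact (p.concat_dropLast _).symm
  simp only [Walk.length_concat, Walk.edges_concat, List.concat_eq_append, List.mem_append,
    List.mem_singleton, not_or] at hlen hc
  have hyz : y ≠ z := by
    rintro rfl
    exact hc.2.2 (Sym2.eq_swap)
  have hq : q.IsPath ∧ v ∉ q.support := by
    have := hc.1
    rw [Walk.isPath_def, Walk.support_concat, List.nodup_append] at this
    exact ⟨by rw [Walk.isPath_def]; exact this.1, fun hv => this.2.2 v hv v (by simp) rfl⟩
  have hyz' : ¬ G.Adj y z := by
    intro hA
    have hcyc : (Walk.cons hvy (Walk.cons hA (Walk.cons hzv Walk.nil))).IsCycle := by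
      rw [Walk.cons_isCycle_iff]
      have := hvy.ne
      have := hzv.ne
      have := hA.ne
      simp [*]
      tauto
    have := egirth_le_length hcyc
    rw [he] at this
    simp at this
    have : h + 1 ≤ 3 := by exact_mod_cast this
    omega
  let G1 := G.deleteEdges {s(v, y)}
  have hvz1 : G1.Adj v z := by
    simp only [G1, deleteEdges_adj, Set.mem_singleton_iff]
    refine ⟨hzv.symm, fun hh => ?_⟩
    have := Sym2.congr_right.1 hh
    exact hyz this.symm
  let G2 := G1.deleteEdges {s(v, z)}
  have h21 : G2 ≤ G1 := deleteEdges_le _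
  have h1 : G1 ≤ G := deleteEdges_le _
  let P := G2 ⊔ edge y z
  have hPv : ∀ u, (P.neighborSet u).ncard + (if u = v then 1 else 0) + (if u = v then 1 else 0)
      = k := by
    intro u
    rw [← hG u]
    have e1 := ncard_neighborSet_deleteEdges hvy u
    have e2 := ncard_neighborSet_deleteEdges hvz1 u
    have e3 := ncard_neighborSet_sup_edge (G := G2) hyz (fun hh => hyz' (h1 (h21 hh))) u
    simp only [G1, G2, P] at e1 e2 e3 ⊢
    omega
  have hge : (h : ℕ∞) ≤ P.egirth := by
    apply le_egirth_sup_edge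
    · refine le_trans ?_ (egirth_anti (h21.trans h1))
      rw [he]
      exact_mod_cast Nat.le_succ h
    · intro w
      have hy : ¬ G2.Adj v y := by simp [G2, G1]
      have h3 := le_length_of_walk_deleteEdges (G := G) (g := h + 1) he.ge hvy
        (Walk.concat ((w.mapLe h21).reverse.reverse) hvz1.symm)
      simp at h3
      omega
  have hle : P.egirth ≤ h := by
    by_contra hlt
    have hlt : ((h + 1 : ℕ) : ℕ∞) ≤ P.egirth := by
      have := not_le.1 hlt
      exact_mod_cast Order.add_one_le_of_lt this
    have hsub : ∀ e ∈ q.edges, e ∈ (P.deleteEdges {s(z, y)}).edgeSet := by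
      intro e hee
      induction e with
      | h a b =>
        have hab := q.adj_of_mem_edges hee
        have ha : a ≠ v := fun hh => hq.2 (hh ▸ q.fst_mem_support_of_mem_edges hee)
        have hb : b ≠ v := fun hh => hq.2 (hh ▸ q.snd_mem_support_of_mem_edges hee)
        simp only [mem_edgeSet, deleteEdges_adj, P, G2, G1, sup_adj, Set.mem_singleton_iff,
          Sym2.eq_iff]
        refine ⟨Or.inl ⟨⟨hab, by tauto⟩, by tauto⟩, ?_⟩
        rintro (⟨rfl, rfl⟩ | ⟨rfl, rfl⟩)
        · exact hyz' hab.symm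
        · exact hyz' hab
    have := le_length_of_walk_deleteEdges (G := P) hlt (u := z) (v := y)
      (by simp [P, edge_adj, hyz.symm, hyz]) (q.transfer _ hsub)
    rw [Walk.length_transfer] at this
    omega
  have hA := hvy
  refine ⟨joinTwo (G.deleteEdges {s(v, y)}) P v y v v, ?_, le_antisymm ?_ ?_⟩
  · rintro (u | w)
    · rw [ncard_neighborSet_joinTwo_inl hvy.ne, ncard_neighborSet_deleteEdges hvy, hG u]
    · rw [ncard_neighborSet_joinTwo_inr hvy.ne, hPv]
  · exact egirth_joinTwo_le_right.trans hle
  · refine le_egirth_joinTwo ?_ hge ?_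
    · refine le_trans ?_ (egirth_anti h1)
      rw [he]
      exact_mod_cast Nat.le_succ h
    · intro w
      have := le_length_of_walk_deleteEdges (G := G) (g := h + 1) he.ge hvy w.reverse
      simp at this
      omega

theorem exists_connected_regular_le_egirth (k g : ℕ) :
    ∃ (V : Type) (_ : Finite V) (G : SimpleGraph V), G.Connected ∧ IsRegular' k G ∧
      (g : ℕ∞) ≤ G.egirth := by
  have hr : 1 ≤ g + 1 := by omega
  let G := toggleGraph k (g + 1) hr
  have hG : IsRegular' k G := ncard_neighborSet_toggleGraph hr
  refine ⟨_, inferInstance, (G.connectedComponentMk 1).toSimpleGraph,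
    ConnectedComponent.connected_toSimpleGraph _, isRegular'_toSimpleGraph hG _, ?_⟩
  refine le_egirth_comap (le_trans ?_ (le_egirth_toggleGraph hr)) Subtype.val_injective
  exact_mod_cast (by omega : g ≤ g + 1 + 1)

theorem exists_connected_regular_egirth_eq (hk : 3 ≤ k) {g : ℕ} (hg : 3 ≤ g) :
    ∃ (V : Type) (_ : Finite V) (G : SimpleGraph V), G.Connected ∧ IsRegular' k G ∧
      G.egirth = g := by
  have key : ∀ n : ℕ, ∀ (V : Type) (_ : Finite V) (G : SimpleGraph V), IsRegular' k G →
      G.egirth = ((g + n : ℕ) : ℕ∞) →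
      ∃ (V : Type) (_ : Finite V) (G : SimpleGraph V), IsRegular' k G ∧ G.egirth = g := by
    intro n
    induction n with
    | zero => exact fun V hV G h1 h2 => ⟨V, hV, G, h1, h2⟩
    | succ n ih =>
      intro V hV G h1 h2
      obtain ⟨H, h3, h4⟩ := exists_regular_egirth_pred (h := g + n) (by omega) h1 h2
      exact ih _ inferInstance H h3 h4
  obtain ⟨V, hV, G, hc, hG, hgi⟩ := exists_connected_regular_le_egirth k g
  obtain ⟨n, hn⟩ := exists_egirth_eq_natCast (by omega) hG hc
  obtain ⟨m, rfl⟩ : ∃ m, n = g + m := Nat.exists_eq_add_of_le (by rw [hn] at hgi; exact_mod_cast hgi)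
  obtain ⟨V, hV, G, hG, he⟩ := key m V hV G hG hn
  obtain ⟨a, c, hc, hlen⟩ := (exists_egirth_eq_length (G := G)).2 (by
    rw [← egirth_eq_top, he]; exact ENat.natCast_ne_top _)
  refine ⟨_, inferInstance, (G.connectedComponentMk a).toSimpleGraph,
    ConnectedComponent.connected_toSimpleGraph _, isRegular'_toSimpleGraph hG _, le_antisymm ?_ ?_⟩
  · rw [← he, hlen]
    exact egirth_toSimpleGraph_le hc
  · rw [← he]
    exact he ▸ le_egirth_comap he.ge Subtype.val_injective

end Existence

section Tail

variable {V W : Type*} {k g : ℕ}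

theorem dist_le_of_adj {G : SimpleGraph V} (hG : G.Connected) {u v : V} (h : G.Adj u v) (z : V) :
    G.dist u z ≤ G.dist v z + 1 := by
  have := hG.dist_triangle (u := u) (v := v) (w := z)
  rw [dist_eq_one_iff_adj.2 h] at this
  omega

theorem dist_map_le {G : SimpleGraph V} {H : SimpleGraph W} (hG : G.Connected) (f : G →g H)
    (u v : V) : H.dist (f u) (f v) ≤ G.dist u v := by
  obtain ⟨w, hw⟩ := hG.exists_walk_length_eq_dist u v
  rw [← hw, ← Walk.length_map f]
  exact dist_le _

theorem le_add_dist {G : SimpleGraph V} (hG : G.Connected) (f : V → ℕ)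
    (hf : ∀ u v, G.Adj u v → f u ≤ f v + 1) (u v : V) : f u ≤ f v + G.dist u v := by
  obtain ⟨w, hw⟩ := hG.exists_walk_length_eq_dist u v
  rw [← hw]
  exact add_length_of_lipschitz f hf w

/-- A connected graph of girth `g` that is `k`-regular except for a root of degree `k - 2`, all of
whose vertices are at distance at most `t` from the root, with equality for some vertex. -/
structure IsTail (k g t : ℕ) (T : SimpleGraph W) (ρ : W) : Prop where
  connected : T.Connected
  root_degree : (T.neighborSet ρ).ncard + 2 = k
  degree : ∀ w, w ≠ ρ → (T.neighborSet w).ncard = k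
  girth : T.egirth = g
  dist_le : ∀ w, T.dist ρ w ≤ t
  exists_dist : ∃ w, T.dist ρ w = t

theorem exists_isTail (hk : 3 ≤ k) (hg : 3 ≤ g) :
    ∃ (W : Type) (_ : Finite W) (T : SimpleGraph W) (ρ : W) (t : ℕ), IsTail k g t T ρ := by
  classical
  obtain ⟨V, hV, K, hc, hK, he⟩ := exists_connected_regular_egirth_eq hk hg
  have hnt : Nontrivial V := by
    obtain ⟨v⟩ := hc.nonempty
    have : (K.neighborSet v).Nonempty := by
      rw [← Set.ncard_pos (Set.toFinite _), hK v]; omega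
    obtain ⟨w, hw⟩ := this
    exact ⟨v, w, Adj.ne hw⟩
  obtain ⟨v, hv⟩ := hc.exists_connected_induce_compl_singleton_of_finite_nontrivial
  obtain ⟨y, hy, z, hz, w, hw, hyz, hyw, hzw⟩ : ∃ y ∈ K.neighborSet v, ∃ z ∈ K.neighborSet v,
      ∃ w ∈ K.neighborSet v, y ≠ z ∧ y ≠ w ∧ z ≠ w := by
    have : 2 < (K.neighborSet v).ncard := by rw [hK v]; omega
    obtain ⟨y, h1, z, h2, w, h3, h⟩ := (Set.two_lt_ncard (Set.toFinite _)).1 this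
    exact ⟨y, h1, z, h2, w, h3, h⟩
  rw [mem_neighborSet] at hy hz hw
  let A1 := K.deleteEdges {s(v, y)}
  have hvz : A1.Adj v z := by
    simp only [A1, deleteEdges_adj, Set.mem_singleton_iff]
    exact ⟨hz, fun hh => hyz (Sym2.congr_right.1 hh).symm⟩
  let A := A1.deleteEdges {s(v, z)}
  have hA1 : A1 ≤ K := deleteEdges_le _
  have hA : A ≤ K := (deleteEdges_le _).trans hA1
  have hvw : A.Adj v w := by
    simp only [A, A1, deleteEdges_adj, Set.mem_singleton_iff]
    exact ⟨⟨hw, fun hh => hyw (Sym2.congr_right.1 hh).symm⟩,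
      fun hh => hzw (Sym2.congr_right.1 hh).symm⟩
  have hAc : A.Connected := by
    let f : K.induce {v}ᶜ →g A := ⟨Subtype.val, by
      rintro ⟨a, ha⟩ ⟨b, hb⟩ hab
      simp only [Set.mem_compl_iff, Set.mem_singleton_iff] at ha hb
      have hab : K.Adj a b := hab
      simp only [A, A1, deleteEdges_adj, Set.mem_singleton_iff, Sym2.eq_iff]
      exact ⟨⟨hab, by tauto⟩, by tauto⟩⟩
    have hr : ∀ u, A.Reachable u w := by
      intro u
      by_cases huv : u = v
      · rw [huv]; exact hvw.reachable
      · exact (hv.preconnected ⟨u, huv⟩ ⟨w, hw.ne'⟩).map f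
    exact (connected_iff _).2 ⟨fun a b => (hr a).trans (hr b).symm, ⟨v⟩⟩
  have hAd : ∀ u, (A.neighborSet u).ncard + (if u = y then 1 else 0) + (if u = z then 1 else 0)
      + (if u = v then 2 else 0) = k := by
    intro u
    have e1 := ncard_neighborSet_deleteEdges hy u
    have e2 := ncard_neighborSet_deleteEdges hvz u
    rw [hK u] at e1
    simp only [A, A1] at e1 e2 ⊢
    split_ifs at * <;> omega
  obtain ⟨a, c, hcy, hlen⟩ := (exists_egirth_eq_length (G := K)).2 (by
    rw [← egirth_eq_top, he]; exact ENat.natCast_ne_top _)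
  obtain ⟨b, hab, hbc⟩ : ∃ b, K.Adj a b ∧ s(a, b) ∉ c.edges := by
    by_contra! hcon
    have h2 := hcy.ncard_neighborSet_toSubgraph_eq_two c.start_mem_support
    have : K.neighborSet a ⊆ c.toSubgraph.neighborSet a := by
      intro b hb
      have := hcon b hb
      rwa [← Walk.mem_edges_toSubgraph, Subgraph.mem_edgeSet] at this
    have := Set.ncard_le_ncard this (Set.toFinite _)
    rw [h2, hK a] at this
    omega
  let B := K.deleteEdges {s(a, b)}
  have hB : B ≤ K := deleteEdges_le _
  have hBg : B.egirth ≤ g := by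
    have hs : ∀ e ∈ c.edges, e ∈ B.edgeSet := by
      intro e hee
      simp only [B, edgeSet_deleteEdges, Set.mem_sdiff, Set.mem_singleton_iff]
      exact ⟨c.edges_subset_edgeSet hee, fun hh => hbc (hh ▸ hee)⟩
    have := egirth_le_length (hcy.transfer hs)
    rwa [Walk.length_transfer, ← hlen, he] at this
  have hTc : (joinTwo B A a b y z).Connected :=
    connected_joinTwo hAc (reachable_deleteEdges_or hc hab)
  have hTi : ∀ u, u ≠ v → ((joinTwo B A a b y z).neighborSet (Sum.inr u)).ncard = k := by
    intro u hu
    have := hAd u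
    rw [ncard_neighborSet_joinTwo_inr hab.ne]
    simpa [hu] using this
  obtain ⟨w0, hw0⟩ := @Finite.exists_max (V ⊕ V) _ _ ⟨Sum.inr v⟩ _
    (fun x => (joinTwo B A a b y z).dist (Sum.inr v) x)
  refine ⟨V ⊕ V, inferInstance, joinTwo B A a b y z, Sum.inr v,
    (joinTwo B A a b y z).dist (Sum.inr v) w0, hTc, ?_, ?_, ?_, hw0, w0, rfl⟩
  · rw [ncard_neighborSet_joinTwo_inr hab.ne]
    simpa using hAd v
  · rintro (u | u) hu
    · rw [ncard_neighborSet_joinTwo_inl hab.ne, ncard_neighborSet_deleteEdges hab, hK u]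
    · exact hTi u (fun hh => hu (hh ▸ rfl))
  · refine le_antisymm (egirth_joinTwo_le_left.trans hBg) (le_egirth_joinTwo ?_ ?_ ?_)
    · exact he ▸ egirth_anti hB
    · exact he ▸ egirth_anti hA
    · intro w
      have := le_length_of_walk_deleteEdges he.ge hab w.reverse
      simp at this
      omega

section Join

variable {S : SimpleGraph V} {T : SimpleGraph W} {x y : V} {ρ : W} {t : ℕ}

/-- The graph obtained from `S` by subdividing the edge `x y` and gluing the root `ρ` of `T` to the
new vertex. -/
abbrev attach (S : SimpleGraph V) (T : SimpleGraph W) (x y : V) (ρ : W) : SimpleGraph (V ⊕ W) :=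
  joinTwo (S.deleteEdges {s(x, y)}) T x y ρ ρ

theorem connected_attach (hS : S.Connected) (hT : T.Connected) (hxy : S.Adj x y) :
    (attach S T x y ρ).Connected :=
  connected_joinTwo hT (reachable_deleteEdges_or hS hxy)

theorem le_egirth_attach (hS : (g : ℕ∞) ≤ S.egirth) (hT : (g : ℕ∞) ≤ T.egirth) (hxy : S.Adj x y) :
    (g : ℕ∞) ≤ (attach S T x y ρ).egirth := by
  refine le_egirth_joinTwo (hS.trans (egirth_anti (deleteEdges_le _))) hT fun w => ?_
  have := le_length_of_walk_deleteEdges hS hxy w.reverse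
  simp at this
  omega

theorem egirth_attach (hS : (g : ℕ∞) ≤ S.egirth) (hT : T.egirth = g) (hxy : S.Adj x y) :
    (attach S T x y ρ).egirth = g :=
  le_antisymm (egirth_joinTwo_le_right.trans hT.le) (le_egirth_attach hS hT.ge hxy)

theorem ncard_neighborSet_attach_inl [Finite V] [Finite W] (hxy : S.Adj x y) (u : V) :
    ((attach S T x y ρ).neighborSet (Sum.inl u)).ncard = (S.neighborSet u).ncard := by
  classical
  rw [ncard_neighborSet_joinTwo_inl hxy.ne, ncard_neighborSet_deleteEdges hxy]

theorem ncard_neighborSet_attach_inr [Finite V] [Finite W] (hxy : S.Adj x y) (hT : IsTail k g t T ρ)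
    (w : W) : ((attach S T x y ρ).neighborSet (Sum.inr w)).ncard = k := by
  classical
  rw [ncard_neighborSet_joinTwo_inr hxy.ne]
  by_cases h : w = ρ
  · subst h
    simpa using hT.root_degree
  · simpa [h] using hT.degree w h

theorem dist_attach_inl_le (hS : S.Connected) (hxy : S.Adj x y) (a b : V) :
    (attach S T x y ρ).dist (Sum.inl a) (Sum.inl b) ≤ S.dist a b + 1 := by
  obtain ⟨w, hw⟩ := hS.exists_walk_length_eq_dist a b
  have hle : S ≤ S.deleteEdges {s(x, y)} ⊔ edge x y := (deleteEdges_sup_edge hxy).ge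
  let f := joinTwoInl (S.deleteEdges {s(x, y)}) T x y ρ ρ
  have hx : (attach S T x y ρ).Adj (f x) (Sum.inr ρ) := by simp [f, joinTwoInl]
  have hy : (attach S T x y ρ).Adj (Sum.inr ρ) (f y) := by simp [f, joinTwoInl]
  rcases exists_walk_of_sup_edge (w.mapLe hle) with ⟨p, hp⟩ | ⟨p, q, hp⟩ | ⟨p, q, hp⟩
  · have := dist_le (p.map f)
    simp only [Walk.length_map] at this hp
    exact this.trans (by omega)
  · have := dist_le ((p.map f).append (Walk.cons hx (Walk.cons hy (q.map f))))
    simp only [Walk.length_append, Walk.length_cons, Walk.length_map] at this hp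
    exact this.trans (by omega)
  · have := dist_le ((p.map f).append (Walk.cons hy.symm (Walk.cons hx.symm (q.map f))))
    simp only [Walk.length_append, Walk.length_cons, Walk.length_map] at this hp
    exact this.trans (by omega)

theorem dist_attach_inr_le (hT : T.Connected) (a b : W) :
    (attach S T x y ρ).dist (Sum.inr a) (Sum.inr b) ≤ T.dist a b :=
  dist_map_le hT (joinTwoInr (S.deleteEdges {s(x, y)}) T x y ρ ρ) a b

theorem IsTail.succ [Finite V] [Finite W] {t₀ : ℕ} (hS : IsTail k g t₀ S x) (hT : IsTail k g t T ρ)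
    (hxy : S.Adj x y) (ht : t₀ ≤ t) : IsTail k g (t + 1) (attach S T x y ρ) (Sum.inl x) := by
  have hc := connected_attach (ρ := ρ) hS.connected hT.connected hxy
  have hxr : (attach S T x y ρ).dist (Sum.inl x) (Sum.inr ρ) = 1 :=
    dist_eq_one_iff_adj.2 (by simp)
  have hle : ∀ z, (attach S T x y ρ).dist (Sum.inl x) z ≤ t + 1 := by
    rintro (u | w)
    · have := dist_attach_inl_le (T := T) (ρ := ρ) hS.connected hxy x u
      have := hS.dist_le u
      omega
    · have h1 := hc.dist_triangle (u := Sum.inl x) (v := Sum.inr ρ) (w := Sum.inr w)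
      have h2 := dist_attach_inr_le (S := S) (x := x) (y := y) (ρ := ρ) hT.connected ρ w
      have := hT.dist_le w
      omega
  refine ⟨hc, ?_, ?_, egirth_attach hS.girth.ge hT.girth hxy, hle, ?_⟩
  · rw [ncard_neighborSet_attach_inl hxy, hS.root_degree]
  · rintro (u | w) h
    · rw [ncard_neighborSet_attach_inl hxy]
      exact hS.degree u fun hh => h (hh ▸ rfl)
    · exact ncard_neighborSet_attach_inr hxy hT w
  · obtain ⟨w, hw⟩ := hT.exists_dist
    refine ⟨Sum.inr w, le_antisymm (hle _) ?_⟩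
    have := le_add_dist hc (fun z => z.elim (fun _ => 0) (fun τ => T.dist τ ρ + 1)) ?_ (Sum.inr w)
      (Sum.inl x)
    · simp only [Sum.elim_inr, Sum.elim_inl] at this
      rw [dist_comm, hw, dist_comm] at this
      omega
    · rintro (u | u) (v | v) huv
      · simp
      · simp
      · simp only [joinTwo_inr_inl] at huv
        have : u = ρ := by tauto
        simp [this]
      · simp only [joinTwo_inr_inr] at huv
        have := dist_le_of_adj hT.connected huv ρ
        simpa using this

end Join

theorem exists_isTail_of_le (hk : 3 ≤ k) (hg : 3 ≤ g) : ∃ t₀ c : ℕ, ∀ t, t₀ ≤ t →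
    ∃ (W : Type) (_ : Finite W) (T : SimpleGraph W) (ρ : W), IsTail k g t T ρ ∧
      Nat.card W ≤ c * (t + 1) := by
  obtain ⟨W₀, hW₀, T₀, ρ₀, t₀, h₀⟩ := exists_isTail hk hg
  refine ⟨t₀, Nat.card W₀, fun t ht => ?_⟩
  induction t, ht using Nat.le_induction with
  | base => exact ⟨W₀, hW₀, T₀, ρ₀, h₀, Nat.le_mul_of_pos_right _ (by omega)⟩
  | succ t ht ih =>
    obtain ⟨W, hW, T, ρ, hT, hcard⟩ := ih
    obtain ⟨y, hy⟩ : ∃ y, T₀.Adj ρ₀ y := by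
      have : (T₀.neighborSet ρ₀).Nonempty := by
        rw [← Set.ncard_pos (Set.toFinite _)]
        have := h₀.root_degree
        omega
      exact this
    refine ⟨W₀ ⊕ W, inferInstance, _, _, h₀.succ hT hy ht, ?_⟩
    rw [Nat.card_sum]
    nlinarith

/-- Connected regular graphs of linear order and large diameter. -/
theorem exists_connected_regular_linear (hk : 3 ≤ k) (hg : 3 ≤ g) : ∃ c C t₀ : ℕ, ∀ t, t₀ ≤ t →
    ∃ (V : Type) (_ : Finite V) (G : SimpleGraph V), G.Connected ∧ IsRegular' k G ∧
      (g : ℕ∞) ≤ G.egirth ∧ Nat.card V ≤ c * t + C ∧ ∃ u v, t ≤ G.dist u v := by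
  obtain ⟨t₀, c, h⟩ := exists_isTail_of_le hk hg
  obtain ⟨V, hV, K, hc, hK, he⟩ := exists_connected_regular_egirth_eq hk hg
  obtain ⟨x⟩ := hc.nonempty
  obtain ⟨y, hy⟩ : ∃ y, K.Adj x y := by
    have : (K.neighborSet x).Nonempty := by
      rw [← Set.ncard_pos (Set.toFinite _), hK]
      omega
    exact this
  refine ⟨c, c + Nat.card V, t₀, fun t ht => ?_⟩
  obtain ⟨W, hW, T, ρ, hT, hcard⟩ := h t ht
  have hcon := connected_attach (ρ := ρ) hc hT.connected hy
  refine ⟨V ⊕ W, inferInstance, attach K T x y ρ, hcon, ?_,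
    le_egirth_attach he.ge hT.girth.ge hy, ?_, ?_⟩
  · rintro (u | w)
    · rw [ncard_neighborSet_attach_inl hy, hK]
    · exact ncard_neighborSet_attach_inr hy hT w
  · rw [Nat.card_sum]
    linarith
  · obtain ⟨w, hw⟩ := hT.exists_dist
    refine ⟨Sum.inr w, Sum.inr ρ, ?_⟩
    have := le_add_dist hcon (fun z => z.elim (fun _ => 0) (fun τ => T.dist τ ρ)) ?_ (Sum.inr w)
      (Sum.inr ρ)
    · simp only [Sum.elim_inr, dist_self] at this
      rw [dist_comm, hw] at this
      omega
    · rintro (u | u) (v | v) huv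
      · simp
      · simp
      · simp only [joinTwo_inr_inl] at huv
        have : u = ρ := by tauto
        simp [this]
      · simp only [joinTwo_inr_inr] at huv
        simpa using dist_le_of_adj hT.connected huv ρ

/-- Attaching a tail of suitable length to a graph produces a graph with prescribed diameter. -/
theorem exists_attach_isKGDGraph [Finite V] {S : SimpleGraph V} {e : ℕ} (hk : 3 ≤ k)
    (hS : S.Connected) (hSk : IsRegular' k S) (hSg : (g : ℕ∞) ≤ S.egirth)
    (hle : ∀ a b, S.dist a b ≤ e) (hex : ∃ a b, S.dist a b = e) :
    ∃ E, e ≤ E ∧ E ≤ e + 2 ∧ ∀ (t : ℕ) (W : Type) (_ : Finite W) (T : SimpleGraph W) (ρ : W),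
      IsTail k g t T ρ → 1 ≤ t → 2 * t ≤ E + t →
      ∃ G : SimpleGraph (V ⊕ W), IsKGDGraph k g (E + t) G := by
  obtain ⟨x, z, hxz⟩ := hex
  obtain ⟨y, hy⟩ : ∃ y, S.Adj x y := by
    have : (S.neighborSet x).Nonempty := by
      rw [← Set.ncard_pos (Set.toFinite _), hSk]
      omega
    exact this
  let G₀ := attach S (⊥ : SimpleGraph Unit) x y ()
  have hc₀ : G₀.Connected := connected_attach hS
    ((connected_iff _).2 ⟨fun _ _ => Reachable.refl _, ⟨()⟩⟩) hy
  obtain ⟨m, hm⟩ := @Finite.exists_max V _ _ ⟨x⟩ _ (fun u => G₀.dist (Sum.inr ()) (Sum.inl u))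
  have hxr : G₀.dist (Sum.inr ()) (Sum.inl x) = 1 :=
    dist_eq_one_iff_adj.2 (by simp [G₀])
  have hz : e ≤ G₀.dist (Sum.inr ()) (Sum.inl z) := by
    have := le_add_dist hc₀ (fun v => v.elim (fun u => S.dist u z) (fun _ => e)) ?_ (Sum.inr ())
      (Sum.inl z)
    · simpa using this
    · have hyz := dist_le_of_adj hS hy z
      rintro (u | u) (v | v) huv
      · simp only [G₀, joinTwo_inl_inl, deleteEdges_adj] at huv
        simpa using dist_le_of_adj hS huv.1 z
      · simpa using (hle u z).trans (by omega)
      · simp only [G₀, joinTwo_inr_inl] at huv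
        rcases huv with ⟨rfl, -⟩ | ⟨rfl, -⟩
        · simp [hxz]
        · simpa [hxz] using hyz
      · simp
  refine ⟨G₀.dist (Sum.inr ()) (Sum.inl m), hz.trans (hm z), ?_, ?_⟩
  · have h1 := hc₀.dist_triangle (u := Sum.inr ()) (v := Sum.inl x) (w := Sum.inl m)
    have h2 := dist_attach_inl_le (T := (⊥ : SimpleGraph Unit)) (ρ := ()) hS hy x m
    have := hle x m
    simp only [G₀] at *
    omega
  intro t W hW T ρ hT ht1 ht2
  set E := G₀.dist (Sum.inr ()) (Sum.inl m) with hE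
  let G := attach S T x y ρ
  have hc : G.Connected := connected_attach hS hT.connected hy
  have hup : ∀ w u, G.dist (Sum.inr w) (Sum.inl u) ≤ t + E := by
    intro w u
    let f : G₀ →g G := ⟨Sum.map id (fun _ => ρ), by
      rintro (a | a) (b | b) hab <;> simpa [G₀, G] using hab⟩
    have h1 : G.dist (Sum.inr ρ) (Sum.inl u) ≤ G₀.dist (Sum.inr ()) (Sum.inl u) :=
      dist_map_le hc₀ f (Sum.inr ()) (Sum.inl u)
    have h2 := dist_attach_inr_le (S := S) (x := x) (y := y) (ρ := ρ) hT.connected ρ w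
    have h3 := hc.dist_triangle (u := Sum.inr w) (v := Sum.inr ρ) (w := Sum.inl u)
    have h4 := hT.dist_le w
    have h5 := hm u
    rw [dist_comm (u := Sum.inr w) (v := Sum.inr ρ)] at h3
    simp only [G] at *
    omega
  have hall : ∀ a b, G.dist a b ≤ E + t := by
    rintro (a | a) (b | b)
    · have h1 := dist_attach_inl_le (T := T) (ρ := ρ) hS hy a b
      have h2 := hle a b
      have h3 := hm z
      simp only [G] at *
      omega
    · rw [dist_comm]
      exact (hup b a).trans (by omega)
    · exact (hup a b).trans (by omega)
    · have h2 := dist_attach_inr_le (S := S) (x := x) (y := y) (ρ := ρ) hT.connected a ρ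
      have h2' := dist_attach_inr_le (S := S) (x := x) (y := y) (ρ := ρ) hT.connected ρ b
      have h3 := hc.dist_triangle (u := Sum.inr a) (v := Sum.inr ρ) (w := Sum.inr b)
      have h4 := hT.dist_le a
      have h5 := hT.dist_le b
      rw [dist_comm (G := T) (u := a)] at h2
      simp only [G] at *
      omega
  refine ⟨G, ?_, egirth_attach hSg hT.girth hy, le_antisymm ?_ ?_⟩
  · rintro (u | w)
    · rw [ncard_neighborSet_attach_inl hy, hSk]
    · exact ncard_neighborSet_attach_inr hy hT w
  · refine ediam_le_of_edist_le fun u v => ?_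
    rw [← (hc.preconnected u v).coe_dist_eq_edist]
    exact_mod_cast hall u v
  · obtain ⟨w, hw⟩ := hT.exists_dist
    refine le_trans ?_ (edist_le_ediam (u := Sum.inr w) (v := Sum.inl m))
    rw [← (hc.preconnected _ _).coe_dist_eq_edist]
    have := le_add_dist hc (fun v => v.elim (fun u => G₀.dist (Sum.inl u) (Sum.inl m))
      (fun τ => E + T.dist τ ρ)) ?_ (Sum.inr w) (Sum.inl m)
    · simp only [Sum.elim_inr, Sum.elim_inl, dist_self] at this
      rw [dist_comm, hw] at this
      exact_mod_cast (by omega : E + t ≤ G.dist (Sum.inr w) (Sum.inl m))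
    · rintro (u | u) (v | v) huv
      · simp only [G, joinTwo_inl_inl] at huv
        exact dist_le_of_adj hc₀ (by simpa [G₀] using huv) _
      · simp only [G, joinTwo_inl_inr] at huv
        have := dist_le_of_adj hc₀ (u := Sum.inl u) (v := Sum.inr ()) (by simp [G₀]; tauto)
          (Sum.inl m)
        simp only [Sum.elim_inr, Sum.elim_inl]
        omega
      · simp only [G, joinTwo_inr_inl] at huv
        have h1 : u = ρ := by tauto
        have := dist_le_of_adj hc₀ (v := Sum.inl v) (u := Sum.inr ()) (by simp [G₀]; tauto)
          (Sum.inl m)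
        simp only [Sum.elim_inr, Sum.elim_inl, h1, dist_self]
        omega
      · simp only [G, joinTwo_inr_inr] at huv
        have := dist_le_of_adj hT.connected huv ρ
        simp only [Sum.elim_inr]
        omega

end Tail

section Layered

/-- A layer: the number of vertices of the level, the pairs of adjacent vertices inside the level,
and the pairs of adjacent vertices between the level and the next one. -/
abbrev Layer : Type := ℕ × Finset (ℕ × ℕ) × Finset (ℕ × ℕ)

/-- The graph on `ℕ × ℕ` described by a sequence of layers; the first coordinate is the level. -/
def layerGraph (L : ℕ → Layer) : SimpleGraph (ℕ × ℕ) :=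
  SimpleGraph.fromRel fun u v =>
    (v.1 = u.1 ∧ (u.2, v.2) ∈ (L u.1).2.1) ∨ (v.1 = u.1 + 1 ∧ (u.2, v.2) ∈ (L u.1).2.2)

/-- The sequence of layers `L` describes a `k`-regular graph of girth at least `g` that has levels
`0, …, T - 1`, the first of which is a single vertex, such that each vertex has a neighbour in the
preceding level. -/
structure IsLayered (k g T : ℕ) (L : ℕ → Layer) : Prop where
  same_mem : ∀ l a b, (a, b) ∈ (L l).2.1 → a < (L l).1 ∧ b < (L l).1
  next_mem : ∀ l a b, (a, b) ∈ (L l).2.2 → a < (L l).1 ∧ b < (L (l + 1)).1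
  degree : ∀ l a, a < (L l).1 → ((layerGraph L).neighborSet (l, a)).ncard = k
  parent : ∀ l b, b < (L (l + 1)).1 → ∃ a, (a, b) ∈ (L l).2.2
  girth : (g : ℕ∞) ≤ (layerGraph L).egirth
  zero : (L 0).1 = 1
  pos : ∀ l, 0 < (L l).1 ↔ l < T

variable {k g T : ℕ} {L L' : ℕ → Layer}

theorem layerGraph_adj {u v : ℕ × ℕ} : (layerGraph L).Adj u v ↔ u ≠ v ∧
    (((v.1 = u.1 ∧ (u.2, v.2) ∈ (L u.1).2.1) ∨ (v.1 = u.1 + 1 ∧ (u.2, v.2) ∈ (L u.1).2.2)) ∨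
    ((u.1 = v.1 ∧ (v.2, u.2) ∈ (L v.1).2.1) ∨ (u.1 = v.1 + 1 ∧ (v.2, u.2) ∈ (L v.1).2.2))) :=
  SimpleGraph.fromRel_adj _ _ _

theorem level_le_of_adj {u v : ℕ × ℕ} (h : (layerGraph L).Adj u v) : u.1 ≤ v.1 + 1 := by
  rw [layerGraph_adj] at h
  omega

theorem IsLayered.lt_of_adj (hL : IsLayered k g T L) {u v : ℕ × ℕ} (h : (layerGraph L).Adj u v) :
    u.2 < (L u.1).1 := by
  rw [layerGraph_adj] at h
  rcases h.2 with (⟨-, h⟩ | ⟨-, h⟩) | (⟨h', h⟩ | ⟨h', h⟩)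
  · exact (hL.same_mem _ _ _ h).1
  · exact (hL.next_mem _ _ _ h).1
  · rw [h']; exact (hL.same_mem _ _ _ h).2
  · rw [h']; exact (hL.next_mem _ _ _ h).2

theorem layerGraph_adj_shift {m m' s : ℕ} (h : ∀ t ≤ s, L' (m + t) = L (m' + t)) {i j : ℕ}
    (hi : i ≤ s) (hj : j ≤ s) (a b : ℕ) :
    (layerGraph L').Adj (m + i, a) (m + j, b) ↔ (layerGraph L).Adj (m' + i, a) (m' + j, b) := by
  simp only [layerGraph_adj, h i hi, h j hj, ne_eq, Prod.mk.injEq, add_right_inj, add_assoc]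

theorem ncard_neighborSet_shift {m m' s : ℕ} (h : ∀ t ≤ s, L' (m + t) = L (m' + t)) {j a : ℕ}
    (hj : j + 1 ≤ s) (hlow' : ∀ v, (layerGraph L').Adj (m + j, a) v → m ≤ v.1)
    (hlow : ∀ v, (layerGraph L).Adj (m' + j, a) v → m' ≤ v.1) :
    ((layerGraph L').neighborSet (m + j, a)).ncard =
      ((layerGraph L).neighborSet (m' + j, a)).ncard := by
  have : (layerGraph L').neighborSet (m + j, a) =
      (fun v : ℕ × ℕ => (m + (v.1 - m'), v.2)) '' (layerGraph L).neighborSet (m' + j, a) := by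
    ext ⟨x, b⟩
    simp only [mem_neighborSet, Set.mem_image, Prod.mk.injEq, Prod.exists]
    constructor
    · intro hv
      obtain ⟨i, rfl⟩ := Nat.exists_eq_add_of_le (hlow' _ hv)
      have := level_le_of_adj hv.symm
      simp only at this
      exact ⟨m' + i, b, (layerGraph_adj_shift h (by omega) (by omega) _ _).1 hv, by simp, rfl⟩
    · rintro ⟨x', b', hv, rfl, rfl⟩
      obtain ⟨i, rfl⟩ := Nat.exists_eq_add_of_le (hlow _ hv)
      have := level_le_of_adj hv.symm
      simp only at this
      simpa using (layerGraph_adj_shift h (by omega) (by omega) _ _).2 hv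
  rw [this, Set.InjOn.ncard_image]
  rintro ⟨x, b⟩ hx ⟨y, c⟩ hy hxy
  have h1 := hlow _ hx
  have h2 := hlow _ hy
  simp only [Prod.mk.injEq] at hxy h1 h2 ⊢
  exact ⟨by omega, hxy.2⟩

theorem exists_low_of_isCycle {a : ℕ × ℕ} {c : (layerGraph L).Walk a a} :
    ∃ m, ∀ v ∈ c.support, m ≤ v.1 ∧ v.1 ≤ m + c.length := by
  classical
  obtain ⟨u, hu, hmin⟩ := Finset.exists_min_image c.support.toFinset Prod.fst
    ⟨a, by simp⟩
  rw [List.mem_toFinset] at hu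
  refine ⟨u.1, fun v hv => ⟨hmin v (by simpa using hv), ?_⟩⟩
  have hv' : v ∈ (c.rotate u hu).support := (c.mem_support_rotate_iff u hu).2 hv
  have h1 := add_length_of_lipschitz Prod.fst (fun _ _ h => level_le_of_adj h)
    ((c.rotate u hu).takeUntil v hv').reverse
  have h2 := (c.rotate u hu).length_takeUntil_le_length hv'
  rw [Walk.length_rotate] at h2
  rw [Walk.length_reverse] at h1
  omega

/-- A sequence of layers that looks locally like a given one has the same local properties. -/
theorem IsLayered.splice (hL : IsLayered k g T L) (hg : 3 ≤ g) {T' : ℕ}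
    (h : ∀ l, ∃ l', (l = 0 → l' = 0) ∧ ∀ t ≤ g, L' (l + t) = L (l' + t))
    (hpos : ∀ l, 0 < (L' l).1 ↔ l < T') : IsLayered k g T' L' where
  same_mem l a b hab := by
    obtain ⟨l', -, hl⟩ := h l
    have := hl 0 (by omega)
    simp only [add_zero] at this
    rw [this] at hab ⊢
    exact hL.same_mem _ _ _ hab
  next_mem l a b hab := by
    obtain ⟨l', -, hl⟩ := h l
    have := hl 0 (by omega)
    simp only [add_zero] at this
    rw [this] at hab ⊢
    rw [hl 1 (by omega)]
    exact hL.next_mem _ _ _ hab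
  parent l b hb := by
    obtain ⟨l', -, hl⟩ := h l
    have := hl 0 (by omega)
    simp only [add_zero] at this
    rw [hl 1 (by omega)] at hb
    rw [this]
    exact hL.parent _ _ hb
  zero := by
    obtain ⟨l', h0, hl⟩ := h 0
    have := hl 0 (by omega)
    rw [h0 rfl] at this
    rw [show L' 0 = L 0 from this]
    exact hL.zero
  pos := hpos
  degree l a ha := by
    rcases Nat.eq_zero_or_pos l with rfl | hl0
    · obtain ⟨l', h0, hl⟩ := h 0
      obtain rfl := h0 rfl
      have := ncard_neighborSet_shift hl (j := 0) (a := a) (by omega) (by simp) (by simp)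
      simp only [add_zero] at this
      rw [this]
      refine hL.degree _ _ ?_
      rwa [← show L' 0 = L 0 from hl 0 (by omega)]
    · obtain ⟨m, rfl⟩ : ∃ m, l = m + 1 := ⟨l - 1, by omega⟩
      obtain ⟨m', -, hl⟩ := h m
      rw [ncard_neighborSet_shift hl (j := 1) (a := a) (by omega)
        (fun v hv => by have := level_le_of_adj hv; simp at this; omega)
        (fun v hv => by have := level_le_of_adj hv; simp at this; omega)]
      refine hL.degree _ _ ?_
      rwa [← hl 1 (by omega)]
  girth := by
    refine le_egirth_of_injOn hL.girth fun a c hc hlt => ?_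
    obtain ⟨m, hm⟩ := exists_low_of_isCycle (c := c)
    obtain ⟨m', -, hl⟩ := h m
    refine ⟨fun v => (m' + (v.1 - m), v.2), ?_, ?_⟩
    · rintro ⟨x, b⟩ hx ⟨y, c⟩ hy hxy
      have h1 := hm _ hx
      have h2 := hm _ hy
      simp only [Prod.mk.injEq] at hxy h1 h2 ⊢
      exact ⟨by omega, hxy.2⟩
    · rintro ⟨x, b⟩ hx ⟨y, c⟩ hy hxy
      have h1 := hm _ hx
      have h2 := hm _ hy
      simp only at h1 h2
      obtain ⟨i, rfl⟩ := Nat.exists_eq_add_of_le h1.1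
      obtain ⟨j, rfl⟩ := Nat.exists_eq_add_of_le h2.1
      have := (layerGraph_adj_shift hl (i := i) (j := j) (by omega) (by omega) _ _).1 hxy
      simpa using this

/-- The windows of `L` at levels `i` and `i + p` agree. -/
structure IsRepeat (g T : ℕ) (L : ℕ → Layer) (i p : ℕ) : Prop where
  le : g ≤ p
  lt : i + p < T
  eq : ∀ t ≤ g, L (i + t) = L (i + p + t)

/-- The number of vertices of the graph described by `L`. -/
def weight (L : ℕ → Layer) (T : ℕ) : ℕ := ∑ l ∈ Finset.range T, (L l).1

/-- The number of vertices in the levels `i, …, i + p - 1`. -/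
def segWeight (L : ℕ → Layer) (i p : ℕ) : ℕ := ∑ l ∈ Finset.range p, (L (i + l)).1

theorem weight_add (L : ℕ → Layer) (i p : ℕ) : weight L (i + p) = weight L i + segWeight L i p :=
  Finset.sum_range_add _ _ _

theorem segWeight_add (L : ℕ → Layer) (i p q : ℕ) :
    segWeight L i (p + q) = segWeight L i p + segWeight L (i + p) q := by
  simp only [segWeight, Finset.sum_range_add, add_assoc]

variable {i p : ℕ}

theorem IsLayered.cut (hL : IsLayered k g T L) (hg : 3 ≤ g) (hr : IsRepeat g T L i p) :
    ∃ L', IsLayered k g (T - p) L' ∧ weight L' (T - p) + segWeight L i p = weight L T := by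
  refine ⟨fun l => if l < i then L l else L (l + p), hL.splice hg (fun l => ?_) (fun l => ?_), ?_⟩
  · have := hr.lt
    by_cases hli : l ≤ i
    · refine ⟨l, id, fun t ht => ?_⟩
      split_ifs with h
      · rfl
      · obtain ⟨s, hs⟩ : ∃ s, l + t = i + s := ⟨l + t - i, by omega⟩
        rw [hs, hr.eq s (by omega)]
        congr 1; omega
    · refine ⟨l + p, by omega, fun t ht => ?_⟩
      rw [if_neg (by omega)]
      congr 1; omega
  · have := hr.lt
    split_ifs with h
    · rw [hL.pos]; omega
    · rw [hL.pos]; omega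
  · have := hr.lt
    obtain ⟨q, rfl⟩ : ∃ q, T = i + p + q := ⟨T - (i + p), by omega⟩
    rw [show i + p + q - p = i + q by omega, weight_add, weight_add, weight_add, add_assoc,
      add_assoc]
    congr 1
    · refine Finset.sum_congr rfl fun l hl => ?_
      rw [Finset.mem_range] at hl
      simp [hl]
    · rw [add_comm]
      congr 1
      refine Finset.sum_congr rfl fun l hl => ?_
      simp only [add_lt_iff_neg_left, not_lt_zero, if_false]
      congr 2; omega

theorem IsLayered.pump (hL : IsLayered k g T L) (hg : 3 ≤ g) (hr : IsRepeat g T L i p) :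
    ∃ L', IsLayered k g (T + p) L' ∧ IsRepeat g (T + p) L' i p ∧
      segWeight L' i p = segWeight L i p ∧ weight L' (T + p) = weight L T + segWeight L i p := by
  have hlt := hr.lt
  have hle := hr.le
  have hseg : ∀ q, segWeight (fun l => if l < i + p then L l else L (l - p)) (i + p) q =
      segWeight L i q := by
    intro q
    refine Finset.sum_congr rfl fun l hl => ?_
    rw [Finset.mem_range] at hl
    beta_reduce
    rw [if_neg (by omega)]
    congr 2; omega
  have hseg' : segWeight (fun l => if l < i + p then L l else L (l - p)) i p =
      segWeight L i p := by
    refine Finset.sum_congr rfl fun l hl => ?_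
    rw [Finset.mem_range] at hl
    beta_reduce
    rw [if_pos (by omega)]
  refine ⟨fun l => if l < i + p then L l else L (l - p), hL.splice hg (fun l => ?_) (fun l => ?_),
    ⟨hle, by omega, fun t ht => ?_⟩, hseg', ?_⟩
  · by_cases hli : l < i + p
    · refine ⟨l, id, fun t ht => ?_⟩
      split_ifs with h
      · rfl
      · obtain ⟨s, hs⟩ : ∃ s, l + t = i + p + s := ⟨l + t - (i + p), by omega⟩
        rw [hs, ← hr.eq s (by omega)]
        congr 1; omega
    · refine ⟨l - p, by omega, fun t ht => ?_⟩
      rw [if_neg (by omega)]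
      congr 1; omega
  · split_ifs with h
    · rw [hL.pos]; omega
    · rw [hL.pos]; omega
  · rw [if_neg (by omega : ¬ i + p + t < i + p), show i + p + t - p = i + t by omega]
    split_ifs with h
    · rfl
    · obtain rfl : t = p := by omega
      rw [show i + t - t = i + 0 by omega, hr.eq 0 (by omega), add_zero]
  · obtain ⟨q, rfl⟩ : ∃ q, T = i + q := ⟨T - i, by omega⟩
    rw [show i + q + p = i + p + q by omega, weight_add, weight_add, weight_add, hseg, hseg']
    have : weight (fun l => if l < i + p then L l else L (l - p)) i = weight L i := by
      refine Finset.sum_congr rfl fun l hl => ?_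
      rw [Finset.mem_range] at hl
      beta_reduce
      rw [if_pos (by omega)]
    rw [this]
    ring

theorem IsLayered.pump_iterate (hL : IsLayered k g T L) (hg : 3 ≤ g) (hr : IsRepeat g T L i p)
    (m : ℕ) : ∃ L', IsLayered k g (T + m * p) L' ∧
      weight L' (T + m * p) = weight L T + m * segWeight L i p := by
  suffices ∃ L', IsLayered k g (T + m * p) L' ∧ IsRepeat g (T + m * p) L' i p ∧
      segWeight L' i p = segWeight L i p ∧
      weight L' (T + m * p) = weight L T + m * segWeight L i p by
    obtain ⟨L', h1, -, -, h2⟩ := this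
    exact ⟨L', h1, h2⟩
  induction m with
  | zero => exact ⟨L, by simpa using hL, by simpa using hr, rfl, by simp⟩
  | succ m ih =>
    obtain ⟨L', h1, h2, h3, h4⟩ := ih
    obtain ⟨L'', h5, h6, h7, h8⟩ := h1.pump hg h2
    rw [show T + (m + 1) * p = T + m * p + p by ring]
    refine ⟨L'', h5, h6, h7.trans h3, ?_⟩
    rw [h8, h4, h3]
    ring

end Layered

section Optimal

variable {k g T : ℕ} {L : ℕ → Layer}

theorem segWeight_mul (L : ℕ → Layer) (i b R : ℕ) :
    segWeight L i (R * b) = ∑ j ∈ Finset.range R, segWeight L (i + j * b) b := by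
  induction R with
  | zero => simp [segWeight]
  | succ R ih => rw [Nat.succ_mul, segWeight_add, ih, Finset.sum_range_succ]

theorem le_segWeight (L : ℕ → Layer) (i : ℕ) {t b : ℕ} (h : t < b) :
    (L (i + t)).1 ≤ segWeight L i b :=
  Finset.single_le_sum (f := fun l => (L (i + l)).1) (fun _ _ => Nat.zero_le _)
    (Finset.mem_range.2 h)

/-- The layers whose vertices have labels below `n`. -/
def smallLayers (n : ℕ) : Finset Layer :=
  Finset.range (n + 1) ×ˢ (Finset.range n ×ˢ Finset.range n).powerset ×ˢ
    (Finset.range n ×ˢ Finset.range n).powerset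

theorem IsLayered.mem_smallLayers (hL : IsLayered k g T L) {n l : ℕ} (h : (L l).1 ≤ n)
    (h' : (L (l + 1)).1 ≤ n) : L l ∈ smallLayers n := by
  simp only [smallLayers, Finset.mem_product, Finset.mem_range, Finset.mem_powerset]
  refine ⟨by omega, fun ⟨a, b⟩ hab => ?_, fun ⟨a, b⟩ hab => ?_⟩
  · have := hL.same_mem _ _ _ hab
    simp only [Finset.mem_product, Finset.mem_range]
    omega
  · have := hL.next_mem _ _ _ hab
    simp only [Finset.mem_product, Finset.mem_range]
    omega

/-- Either a long run of levels contains a repeat or it contains many vertices. -/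
theorem IsLayered.exists_isRepeat_or_le_segWeight (k g M : ℕ) : ∃ P, 0 < P ∧
    ∀ (T : ℕ) (L : ℕ → Layer), IsLayered k g T L → ∀ i, i + P ≤ T →
    (∃ i p, p ≤ P ∧ IsRepeat g T L i p) ∨ M * P ≤ segWeight L i P := by
  classical
  obtain ⟨b, hb⟩ : ∃ b, b = g + 2 := ⟨_, rfl⟩
  obtain ⟨n, hn⟩ : ∃ n, n = 2 * b * M := ⟨_, rfl⟩
  obtain ⟨A, hA⟩ : ∃ A, A = Fintype.piFinset fun _ : Fin (g + 1) => smallLayers n := ⟨_, rfl⟩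
  obtain ⟨R, hR⟩ : ∃ R, R = 2 * (A.card + 1) := ⟨_, rfl⟩
  refine ⟨R * b, by rw [hR, hb]; positivity, fun T L hL i hi => ?_⟩
  obtain ⟨B, hB⟩ : ∃ B, B = (Finset.range R).filter fun j => segWeight L (i + j * b) b ≤ n :=
    ⟨_, rfl⟩
  have key : ∀ j ∈ Finset.range R, i + (j + 1) * b ≤ i + R * b := fun j hj => by
    rw [Finset.mem_range] at hj
    gcongr
    omega
  by_cases hcard : A.card < B.card
  · left
    obtain ⟨x, hx, y, hy, hxy, he⟩ := Finset.exists_ne_map_eq_of_card_lt_of_maps_to hcard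
      (f := fun j (t : Fin (g + 1)) => L (i + j * b + t)) (by
        intro j hj
        rw [Finset.mem_coe, hB, Finset.mem_filter] at hj
        rw [Finset.mem_coe, hA, Fintype.mem_piFinset]
        intro t
        have := t.2
        exact hL.mem_smallLayers ((le_segWeight L _ (by omega)).trans hj.2)
          ((le_segWeight L (i + j * b) (t := t + 1) (by omega)).trans hj.2))
    wlog hlt : x < y generalizing x y
    · exact this y hy x hx hxy.symm he.symm (by omega)
    rw [hB, Finset.mem_filter] at hx hy
    obtain ⟨q, rfl⟩ := Nat.exists_eq_add_of_lt hlt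
    have h1 := key _ hy.1
    have h2 : (x + q + 1 + 1) * b = x * b + (q + 1) * b + b := by ring
    have h3 : (q + 1) * b = q * b + b := by ring
    refine ⟨i + x * b, (q + 1) * b, by omega, by omega, by omega, fun t ht => ?_⟩
    have := congrFun he ⟨t, by omega⟩
    simp only at this
    rw [this]
    congr 1
    ring
  · right
    rw [segWeight_mul]
    have h0 := Finset.card_filter_add_card_filter_not (s := Finset.range R)
      fun j => segWeight L (i + j * b) b ≤ n
    rw [Finset.card_range] at h0
    have h1 : ((Finset.range R).filter fun j => ¬ segWeight L (i + j * b) b ≤ n).card + B.card =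
        R := by
      rw [hB]
      omega
    have h2 : ((Finset.range R).filter fun j => ¬ segWeight L (i + j * b) b ≤ n).card * n ≤
        ∑ j ∈ Finset.range R, segWeight L (i + j * b) b := by
      refine le_trans ?_ (Finset.sum_le_sum_of_subset (Finset.filter_subset
        (fun j => ¬ segWeight L (i + j * b) b ≤ n) _))
      rw [← smul_eq_mul]
      refine Finset.card_nsmul_le_sum _ _ _ fun j hj => ?_
      exact (not_le.1 (Finset.mem_filter.1 hj).2).le
    refine le_trans ?_ h2
    calc M * (R * b) = (A.card + 1) * n := by rw [hR, hn]; ring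
      _ ≤ _ := by gcongr; omega

/-- A layered graph without short repeats has many vertices per level. -/
theorem IsLayered.exists_isRepeat_or_le_weight (k g M : ℕ) : ∃ P,
    ∀ (T : ℕ) (L : ℕ → Layer), IsLayered k g T L →
    (∃ i p, p ≤ P ∧ IsRepeat g T L i p) ∨ M * T ≤ weight L T + M * P := by
  obtain ⟨P, hP, h⟩ := IsLayered.exists_isRepeat_or_le_segWeight k g M
  refine ⟨P, fun T L hL => ?_⟩
  by_cases hr : ∃ i p, p ≤ P ∧ IsRepeat g T L i p
  · exact Or.inl hr
  right
  have h1 : ∀ j ∈ Finset.range (T / P), M * P ≤ segWeight L (0 + j * P) P := by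
    intro j hj
    rw [Finset.mem_range] at hj
    refine (h T L hL _ ?_).resolve_left hr
    calc 0 + j * P + P = (j + 1) * P := by ring
      _ ≤ T / P * P := by gcongr; omega
      _ ≤ T := Nat.div_mul_le_self _ _
  have h2 := Finset.card_nsmul_le_sum _ _ _ h1
  rw [← segWeight_mul, Finset.card_range, smul_eq_mul] at h2
  have h3 : segWeight L 0 (T / P * P) ≤ weight L T := by
    simp only [segWeight, weight, zero_add]
    exact Finset.sum_le_sum_of_subset (Finset.range_mono (Nat.div_mul_le_self _ _))
  have h4 : T ≤ T / P * P + P := (Nat.lt_div_mul_add hP).le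
  calc M * T ≤ M * (T / P * P + P) := by gcongr
    _ = T / P * (M * P) + M * P := by ring
    _ ≤ _ := by omega

theorem IsLayered.le_of_forall_isRepeat (hg : 3 ≤ g) {M P α β : ℕ} (hαβ : α ≤ M * β)
    (hP : ∀ (T : ℕ) (L : ℕ → Layer), IsLayered k g T L →
      (∃ i p, p ≤ P ∧ IsRepeat g T L i p) ∨ M * T ≤ weight L T + M * P)
    (h : ∀ (T : ℕ) (L : ℕ → Layer), IsLayered k g T L → ∀ i p, p ≤ P → IsRepeat g T L i p →
      α * p ≤ β * segWeight L i p) :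
    ∀ (T : ℕ) (L : ℕ → Layer), IsLayered k g T L → α * T ≤ β * (weight L T + M * P) := by
  intro T
  induction T using Nat.strong_induction_on with
  | _ T ih =>
    intro L hL
    rcases hP T L hL with ⟨i, p, hp, hr⟩ | hw
    · obtain ⟨L', hL', hw⟩ := hL.cut hg hr
      have h1 := hr.le
      have h2 := hr.lt
      have h3 := ih (T - p) (by omega) L' hL'
      have h4 := h T L hL i p hp hr
      rw [← hw]
      calc α * T = α * (T - p) + α * p := by rw [← mul_add]; congr 1; omega
        _ ≤ β * (weight L' (T - p) + M * P) + β * segWeight L i p := by gcongr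
        _ = _ := by ring
    · calc α * T ≤ M * β * T := by gcongr
        _ = β * (M * T) := by ring
        _ ≤ _ := by gcongr

/-- There is a repeat of minimal density, and every layered graph has at least that density. -/
theorem exists_optimal_isRepeat (hg : 3 ≤ g)
    (hfam : ∃ a C : ℕ, ∀ T₀, ∃ T, T₀ ≤ T ∧ ∃ L, IsLayered k g T L ∧ weight L T ≤ a * T + C) :
    ∃ (T : ℕ) (L : ℕ → Layer) (i p : ℕ), IsLayered k g T L ∧ IsRepeat g T L i p ∧
      ∃ C', ∀ (T' : ℕ) (L' : ℕ → Layer), IsLayered k g T' L' →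
        segWeight L i p * T' ≤ p * (weight L' T' + C') := by
  obtain ⟨a, C, hfam⟩ := hfam
  obtain ⟨P, hP⟩ := IsLayered.exists_isRepeat_or_le_weight k g (a + 1)
  have hex : ∃ (T : ℕ) (L : ℕ → Layer) (i p : ℕ), IsLayered k g T L ∧ IsRepeat g T L i p ∧ p ≤ P ∧
      segWeight L i p < (a + 1) * p := by
    by_contra! hcon
    obtain ⟨T, hT, L, hL, hw⟩ := hfam (C + (a + 1) * P + 1)
    have := IsLayered.le_of_forall_isRepeat hg (α := a + 1) (β := 1) (by simp) hP
      (fun T L hL i p hp hr => by simpa using hcon T L i p hL hr hp) T L hL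
    rw [add_mul, one_mul, one_mul] at this
    omega
  let S : Set ℕ := {v | ∃ (T : ℕ) (L : ℕ → Layer) (i p : ℕ), IsLayered k g T L ∧
    IsRepeat g T L i p ∧ p ≤ P ∧ v = segWeight L i p * (P.factorial / p)}
  have hdvd : ∀ {p}, g ≤ p → p ≤ P → P.factorial / p * p = P.factorial := fun h1 h2 =>
    Nat.div_mul_cancel (Nat.dvd_factorial (by omega) h2)
  have hmul : ∀ {p}, g ≤ p → p ≤ P → ∀ {x y : ℕ},
      x * (P.factorial / p) ≤ y → x * P.factorial ≤ y * p := fun h1 h2 x y hxy => by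
    rw [← hdvd h1 h2, ← mul_assoc]
    gcongr
  obtain ⟨T₁, L₁, i₁, p₁, hL₁, hr₁, hp₁, hw₁⟩ := hex
  have hS : S.Nonempty := ⟨_, T₁, L₁, i₁, p₁, hL₁, hr₁, hp₁, rfl⟩
  obtain ⟨T, L, i, p, hL, hr, hp, hv⟩ := Nat.sInf_mem hS
  have hmin : ∀ (T' : ℕ) (L' : ℕ → Layer), IsLayered k g T' L' → ∀ i' p', p' ≤ P →
      IsRepeat g T' L' i' p' → segWeight L i p * p' ≤ p * segWeight L' i' p' := by
    intro T' L' hL' i' p' hp' hr'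
    have h1 : segWeight L i p * (P.factorial / p) ≤ segWeight L' i' p' * (P.factorial / p') := by
      rw [← hv]
      exact Nat.sInf_le ⟨T', L', i', p', hL', hr', hp', rfl⟩
    have h2 := hmul hr.le hp h1
    refine Nat.le_of_mul_le_mul_right ?_ P.factorial_pos
    calc segWeight L i p * p' * P.factorial = segWeight L i p * P.factorial * p' := by ring
      _ ≤ segWeight L' i' p' * (P.factorial / p') * p * p' := by gcongr
      _ = p * segWeight L' i' p' * (P.factorial / p' * p') := by ring
      _ = _ := by rw [hdvd hr'.le hp']
  refine ⟨T, L, i, p, hL, hr, (a + 1) * P, IsLayered.le_of_forall_isRepeat hg ?_ hP hmin⟩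
  have h1 := hmin T₁ L₁ hL₁ i₁ p₁ hp₁ hr₁
  have h2 := hr₁.le
  refine Nat.le_of_mul_le_mul_right (h1.trans ?_) (by omega : 0 < p₁)
  calc p * segWeight L₁ i₁ p₁ ≤ p * ((a + 1) * p₁) := by gcongr
    _ = _ := by ring

end Optimal

section Levels

variable {k g T : ℕ} {L : ℕ → Layer}

theorem exists_layerGraph_eq (H : SimpleGraph (ℕ × ℕ)) (n : ℕ → ℕ)
    (hlt : ∀ u v, H.Adj u v → u.2 < n u.1) (hle : ∀ u v, H.Adj u v → u.1 ≤ v.1 + 1) :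
    ∃ L : ℕ → Layer, layerGraph L = H ∧ (∀ l, (L l).1 = n l) ∧
      (∀ l a b, (a, b) ∈ (L l).2.1 ↔ H.Adj (l, a) (l, b)) ∧
      ∀ l a b, (a, b) ∈ (L l).2.2 ↔ H.Adj (l, a) (l + 1, b) := by
  classical
  obtain ⟨A, h1⟩ : ∃ A : ℕ → Finset (ℕ × ℕ), ∀ l a b, (a, b) ∈ A l ↔ H.Adj (l, a) (l, b) := by
    refine ⟨fun l => (Finset.range (n l) ×ˢ Finset.range (n l)).filter
      fun x => H.Adj (l, x.1) (l, x.2), fun l a b => ?_⟩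
    simp only [Finset.mem_filter, Finset.mem_product, Finset.mem_range, and_iff_right_iff_imp]
    exact fun h => ⟨hlt _ _ h, hlt _ _ h.symm⟩
  obtain ⟨B, h2⟩ : ∃ B : ℕ → Finset (ℕ × ℕ), ∀ l a b, (a, b) ∈ B l ↔
      H.Adj (l, a) (l + 1, b) := by
    refine ⟨fun l => (Finset.range (n l) ×ˢ Finset.range (n (l + 1))).filter
      fun x => H.Adj (l, x.1) (l + 1, x.2), fun l a b => ?_⟩
    simp only [Finset.mem_filter, Finset.mem_product, Finset.mem_range, and_iff_right_iff_imp]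
    exact fun h => ⟨hlt _ _ h, hlt _ _ h.symm⟩
  refine ⟨fun l => (n l, A l, B l), ?_, fun _ => rfl, h1, h2⟩
  ext ⟨x, a⟩ ⟨y, b⟩
  simp only [layerGraph_adj, h1, h2]
  constructor
  · rintro ⟨-, (⟨rfl, h⟩ | ⟨rfl, h⟩) | ⟨rfl, h⟩ | ⟨rfl, h⟩⟩
    exacts [h, h, h.symm, h.symm]
  · intro h
    have h3 := hle _ _ h
    have h4 := hle _ _ h.symm
    simp only at h3 h4
    refine ⟨h.ne, ?_⟩
    rcases lt_trichotomy x y with hxy | hxy | hxy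
    · obtain rfl : y = x + 1 := by omega
      exact Or.inl (Or.inr ⟨rfl, h⟩)
    · subst hxy
      exact Or.inl (Or.inl ⟨rfl, h⟩)
    · obtain rfl : x = y + 1 := by omega
      exact Or.inr (Or.inr ⟨rfl, h.symm⟩)

theorem exists_adj_dist_eq {V : Type*} {G : SimpleGraph V} (hG : G.Connected) {u v : V} {l : ℕ}
    (h : G.dist u v = l + 1) : ∃ w, G.Adj w v ∧ G.dist u w = l := by
  obtain ⟨p, hp⟩ := hG.exists_walk_length_eq_dist v u
  cases p with
  | nil => simp at h
  | @cons _ w _ hvw p =>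
    have h1 := dist_le p
    have h2 := dist_le_of_adj hG hvw u
    rw [Walk.length_cons, dist_comm, h] at hp
    rw [dist_comm] at h1
    rw [dist_comm, h, dist_comm] at h2
    exact ⟨w, hvw.symm, by omega⟩

theorem exists_dist_eq_of_le {V : Type*} {G : SimpleGraph V} (hG : G.Connected) {u v : V} {l : ℕ}
    (h : l ≤ G.dist u v) : ∃ w, G.dist u w = l := by
  induction h using Nat.decreasingInduction with
  | self => exact ⟨v, rfl⟩
  | of_succ l _ ih =>
    obtain ⟨w, hw⟩ := ih
    obtain ⟨x, -, hx⟩ := exists_adj_dist_eq hG hw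
    exact ⟨x, hx⟩

/-- The levels of a connected regular graph form a layered graph. -/
theorem exists_isLayered_of_connected {V : Type*} [Finite V] {G : SimpleGraph V}
    (hG : G.Connected) (hk : IsRegular' k G) (hg : (g : ℕ∞) ≤ G.egirth) {u : V} {e : ℕ}
    (hle : ∀ v, G.dist u v ≤ e) (hex : ∃ v, G.dist u v = e) :
    ∃ L, IsLayered k g (e + 1) L ∧ weight L (e + 1) = Nat.card V := by
  classical
  have := Fintype.ofFinite V
  obtain ⟨S, hS⟩ : ∃ S : ℕ → Finset V, ∀ l v, v ∈ S l ↔ G.dist u v = l :=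
    ⟨fun l => Finset.univ.filter fun v => G.dist u v = l, by simp⟩
  let idx : V → ℕ := fun v => (S (G.dist u v)).equivFin ⟨v, (hS _ _).2 rfl⟩
  have hidx : ∀ l v (hv : v ∈ S l), idx v = (S l).equivFin ⟨v, hv⟩ := by
    intro l v hv
    obtain rfl := (hS _ _).1 hv
    rfl
  have hinj : Function.Injective fun v => (G.dist u v, idx v) := by
    intro v w hvw
    simp only [Prod.mk.injEq] at hvw
    have h1 := hidx (G.dist u v) v ((hS _ _).2 rfl)
    have h2 := hidx (G.dist u v) w ((hS _ _).2 hvw.1.symm)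
    rw [h1, h2, Fin.val_inj, EmbeddingLike.apply_eq_iff_eq] at hvw
    simpa using hvw.2
  let φ : V ↪ ℕ × ℕ := ⟨_, hinj⟩
  have hlt : ∀ v, idx v < (S (G.dist u v)).card := fun v => Fin.is_lt _
  have hsurj : ∀ l a, a < (S l).card → ∃ v, φ v = (l, a) := by
    intro l a ha
    obtain ⟨v, hv⟩ := (S l).equivFin.surjective ⟨a, ha⟩
    have h1 := (hS _ _).1 v.2
    refine ⟨v, Prod.ext h1 ?_⟩
    change idx v = a
    rw [hidx l v v.2, hv]
  obtain ⟨L, hL, hn, hs, ht⟩ := exists_layerGraph_eq (G.map φ) (fun l => (S l).card)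
    (by
      intro _ _ h
      obtain ⟨v, w, -, rfl, rfl⟩ := (map_adj φ G _ _).1 h
      exact hlt v)
    (by
      intro _ _ h
      obtain ⟨v, w, hvw, rfl, rfl⟩ := (map_adj φ G _ _).1 h
      have := dist_le_of_adj hG hvw u
      rwa [dist_comm, G.dist_comm (u := w)] at this)
  refine ⟨L, ⟨fun l a b h => ?_, fun l a b h => ?_, fun l a ha => ?_, fun l b hb => ?_, ?_, ?_,
    fun l => ?_⟩, ?_⟩
  · rw [hs, map_adj] at h
    obtain ⟨v, w, -, hv, hw⟩ := h
    simp only [φ, Function.Embedding.coeFn_mk, Prod.mk.injEq] at hv hw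
    rw [hn, ← hv.2, ← hw.2]
    exact ⟨hv.1 ▸ hlt v, hw.1 ▸ hlt w⟩
  · rw [ht, map_adj] at h
    obtain ⟨v, w, -, hv, hw⟩ := h
    simp only [φ, Function.Embedding.coeFn_mk, Prod.mk.injEq] at hv hw
    rw [hn, hn, ← hv.2, ← hw.2]
    exact ⟨hv.1 ▸ hlt v, hw.1 ▸ hlt w⟩
  · rw [hn] at ha
    obtain ⟨v, hv⟩ := hsurj l a ha
    rw [hL, ← hv, neighborSet_map, Set.ncard_image_of_injective _ φ.injective, hk]
  · rw [hn] at hb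
    obtain ⟨v, hv⟩ := hsurj _ b hb
    obtain ⟨w, hw, hw'⟩ := exists_adj_dist_eq hG (congrArg Prod.fst hv)
    refine ⟨idx w, ?_⟩
    rw [ht, map_adj]
    exact ⟨w, v, hw, Prod.ext hw' rfl, hv⟩
  · rw [hL]
    exact le_egirth_map hg φ
  · rw [hn, Finset.card_eq_one]
    refine ⟨u, ?_⟩
    ext v
    rw [hS, hG.dist_eq_zero_iff, Finset.mem_singleton, eq_comm]
  · rw [hn, Finset.card_pos, Nat.lt_succ_iff]
    constructor
    · rintro ⟨v, hv⟩
      rw [hS] at hv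
      exact hv ▸ hle v
    · intro h
      obtain ⟨v, hv⟩ := hex
      obtain ⟨w, hw⟩ := exists_dist_eq_of_le hG (hv ▸ h : l ≤ G.dist u v)
      exact ⟨w, (hS _ _).2 hw⟩
  · rw [Nat.card_eq_fintype_card, ← Finset.card_univ,
      Finset.card_eq_sum_card_fiberwise (f := G.dist u) (t := Finset.range (e + 1))]
    · refine Finset.sum_congr rfl fun l _ => ?_
      rw [hn]
      congr 1
      ext v
      simp [hS]
    · intro v _
      simpa [Nat.lt_succ_iff] using hle v

/-- The vertices of the graph described by `L` in the levels from `i` to `j`. -/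
def vertexSet (L : ℕ → Layer) (i j : ℕ) : Set (ℕ × ℕ) :=
  {x | i ≤ x.1 ∧ x.1 ≤ j ∧ x.2 < (L x.1).1}

theorem vertexSet_eq (L : ℕ → Layer) (i p : ℕ) : vertexSet L i (i + p) =
    ((Finset.range (p + 1)).sigma fun l => Finset.range (L (i + l)).1 : Finset (Σ _ : ℕ, ℕ)).image
      fun x => (i + x.1, x.2) := by
  ext ⟨x, a⟩
  simp only [vertexSet, Set.mem_ofPred_eq, Finset.coe_image, Set.mem_image, Finset.mem_coe,
    Finset.mem_sigma, Finset.mem_range, Prod.mk.injEq]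
  constructor
  · rintro ⟨h1, h2, h3⟩
    obtain ⟨t, rfl⟩ := Nat.exists_eq_add_of_le h1
    exact ⟨⟨t, a⟩, ⟨by simp only; omega, h3⟩, rfl, rfl⟩
  · rintro ⟨⟨t, b⟩, ⟨h1, h2⟩, rfl, rfl⟩
    simp only at h1
    exact ⟨Nat.le_add_right _ _, by simp only; omega, h2⟩

theorem finite_vertexSet (L : ℕ → Layer) (i j : ℕ) : (vertexSet L i j).Finite := by
  refine Set.Finite.subset (s := vertexSet L i (i + j)) ?_ fun x hx => ⟨hx.1, ?_, hx.2.2⟩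
  · rw [vertexSet_eq]
    exact Finset.finite_toSet _
  · exact hx.2.1.trans (by omega)

theorem ncard_vertexSet (L : ℕ → Layer) (i p : ℕ) :
    (vertexSet L i (i + p)).ncard = segWeight L i (p + 1) := by
  rw [vertexSet_eq, Set.ncard_coe_finset, Finset.card_image_of_injective, Finset.card_sigma]
  · simp [segWeight]
  · rintro ⟨a, b⟩ ⟨c, d⟩ h
    simpa using h

theorem ncard_neighborSet_comap {V W : Type*} {G : SimpleGraph W} {f : V → W}
    (hf : Function.Injective f) {v : V} (h : G.neighborSet (f v) ⊆ Set.range f) :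
    ((G.comap f).neighborSet v).ncard = (G.neighborSet (f v)).ncard := by
  rw [← Set.ncard_image_of_injective _ hf]
  congr 1
  ext w
  constructor
  · rintro ⟨x, hx, rfl⟩
    exact hx
  · intro hw
    obtain ⟨x, rfl⟩ := h hw
    exact ⟨x, hw, rfl⟩

/-- A layered graph is a connected regular graph that is at least as long as its levels. -/
theorem IsLayered.exists_connected (hL : IsLayered k g (T + 1) L) :
    ∃ (V : Type) (_ : Finite V) (G : SimpleGraph V), G.Connected ∧ IsRegular' k G ∧
      (g : ℕ∞) ≤ G.egirth ∧ Nat.card V = weight L (T + 1) ∧ ∃ u v, T ≤ G.dist u v := by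
  have hmem : ∀ x : ℕ × ℕ, x.2 < (L x.1).1 → x ∈ vertexSet L 0 (0 + T) := fun x hx =>
    ⟨Nat.zero_le _, by have := (hL.pos x.1).1 (by omega); omega, hx⟩
  have hrange : Set.range (Subtype.val : vertexSet L 0 (0 + T) → ℕ × ℕ) =
    vertexSet L 0 (0 + T) := Subtype.range_val
  have h0 : ((0, 0) : ℕ × ℕ) ∈ vertexSet L 0 (0 + T) := hmem _ (by simp [hL.zero])
  have hT : ((T, 0) : ℕ × ℕ) ∈ vertexSet L 0 (0 + T) := hmem _ ((hL.pos T).2 (by omega))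
  have hcon : ((layerGraph L).comap (Subtype.val : vertexSet L 0 (0 + T) → ℕ × ℕ)).Connected := by
    have hr : ∀ l a (h : (l, a) ∈ vertexSet L 0 (0 + T)),
        ((layerGraph L).comap (Subtype.val : vertexSet L 0 (0 + T) → ℕ × ℕ)).Reachable
          ⟨(0, 0), h0⟩ ⟨(l, a), h⟩ := by
      intro l
      induction l with
      | zero =>
        intro a h
        have := h.2.2
        simp only [hL.zero, Nat.lt_one_iff] at this
        subst this
        rfl
      | succ l ih =>
        intro b h
        obtain ⟨a, ha⟩ := hL.parent l b h.2.2
        refine (ih a (hmem _ (hL.next_mem _ _ _ ha).1)).trans (Adj.reachable ?_)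
        rw [comap_adj, layerGraph_adj]
        exact ⟨by simp, Or.inl (Or.inr ⟨rfl, ha⟩)⟩
    have : Nonempty (vertexSet L 0 (0 + T)) := ⟨⟨_, h0⟩⟩
    exact ⟨fun u v => (hr u.1.1 u.1.2 u.2).symm.trans (hr v.1.1 v.1.2 v.2)⟩
  refine ⟨vertexSet L 0 (0 + T), (finite_vertexSet L 0 (0 + T)).to_subtype,
    (layerGraph L).comap Subtype.val, hcon, fun v => ?_,
    le_egirth_comap hL.girth Subtype.val_injective, ?_, ⟨(T, 0), hT⟩, ⟨(0, 0), h0⟩, ?_⟩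
  · rw [ncard_neighborSet_comap Subtype.val_injective]
    · exact hL.degree _ _ v.2.2.2
    · intro w hw
      rw [hrange]
      exact hmem _ (hL.lt_of_adj hw.symm)
  · rw [Nat.card_coe_set_eq, ncard_vertexSet]
    simp [segWeight, weight]
  · simpa using le_add_dist hcon (fun x => x.1.1) (fun u v h => level_le_of_adj h) ⟨(T, 0), hT⟩
      ⟨(0, 0), h0⟩

end Levels

section Repeatable

variable {V W : Type*} {k g T : ℕ} {L : ℕ → Layer} {i p : ℕ}

theorem image_neighborSet_comap {G : SimpleGraph W} (f : V → W) (v : V) :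
    f '' (G.comap f).neighborSet v = G.neighborSet (f v) ∩ Set.range f := by
  ext w
  constructor
  · rintro ⟨x, hx, rfl⟩
    exact ⟨hx, x, rfl⟩
  · rintro ⟨hw, x, rfl⟩
    exact ⟨x, hw, rfl⟩

/-- If all vertices of `Y` outside `A` have even degree in the graph induced on `Y`, then the sum
of these degrees over `A` is even. -/
theorem even_finsum_ncard_neighborSet {G : SimpleGraph W} {Y A : Set W} (hY : Y.Finite)
    (hA : A ⊆ Y) (h : ∀ x ∈ Y, x ∉ A → Even (G.neighborSet x ∩ Y).ncard) :
    Even (∑ᶠ x ∈ A, (G.neighborSet x ∩ Y).ncard) := by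
  classical
  have := hY.fintype
  have hdeg : ∀ v : Y, (G.comap (Subtype.val : Y → W)).degree v =
      (G.neighborSet v ∩ Y).ncard := by
    intro v
    have := image_neighborSet_comap (G := G) (Subtype.val : Y → W) v
    rw [Subtype.range_val] at this
    rw [← this, Set.ncard_image_of_injective _ Subtype.val_injective,
      ← card_neighborFinset_eq_degree, ← Set.ncard_coe_finset, coe_neighborFinset]
  have h1 : Even (∑ x ∈ hY.toFinset, (G.neighborSet x ∩ Y).ncard) := by
    have h2 : ∑ x ∈ hY.toFinset, (G.neighborSet x ∩ Y).ncard =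
        ∑ v : Y, (G.neighborSet (v : W) ∩ Y).ncard :=
      Finset.sum_subtype _ (fun x => by simp) _
    rw [h2]
    simp_rw [← hdeg]
    rw [sum_degrees_eq_twice_card_edges]
    exact even_two_mul _
  have hAf := hY.subset hA
  rw [finsum_mem_eq_finite_toFinset_sum _ hAf]
  rw [← Finset.sum_sdiff (Set.Finite.toFinset_subset_toFinset.2 hA : hAf.toFinset ⊆ hY.toFinset),
    Nat.even_add] at h1
  refine h1.1 (Finset.even_sum _ fun x hx => ?_)
  rw [Finset.mem_sdiff, Set.Finite.mem_toFinset, Set.Finite.mem_toFinset] at hx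
  exact h x hx.1 hx.2

theorem even_finsum_comap {G : SimpleGraph W} {f : V → W} (hf : Function.Injective f)
    {Y A : Set W} (hY : Y.Finite) (hA : A ⊆ Y) (hAf : A ⊆ Set.range f)
    (h : ∀ x ∈ Y, x ∉ A → Even (G.neighborSet x ∩ Y).ncard)
    (hx : ∀ x ∈ A, G.neighborSet x ∩ Y = G.neighborSet x ∩ Set.range f) :
    Even (∑ᶠ v ∈ f ⁻¹' A, ((G.comap f).neighborSet v).ncard) := by
  have h1 := even_finsum_ncard_neighborSet hY hA h
  rw [← Set.image_preimage_eq_of_subset hAf, finsum_mem_image hf.injOn] at h1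
  convert h1 using 3 with v
  refine finsum_congr fun hv => ?_
  rw [hx _ hv, ← image_neighborSet_comap, Set.ncard_image_of_injective _ hf]

theorem exists_induce_iso {G : SimpleGraph V} {A B : Set V} {σ : V → V} (hσ : Set.BijOn σ A B)
    (h : ∀ u ∈ A, ∀ v ∈ A, G.Adj (σ u) (σ v) ↔ G.Adj u v) :
    ∃ φ : G.induce A ≃g G.induce B, ∀ x, (φ x : V) = σ x :=
  ⟨⟨hσ.equiv, fun {u v} => h u u.2 v v.2⟩, fun _ => rfl⟩

theorem levelSet_comap_layerGraph {D : ℕ} {f : V → ℕ × ℕ} (hL : IsLayered k g T L)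
    (hf : Set.range f = vertexSet L i (i + D)) (t : ℕ) :
    levelSet ((layerGraph L).comap f) {v | (f v).1 = i} t = {v | (f v).1 = i + t} := by
  have hmem : ∀ v, f v ∈ vertexSet L i (i + D) := fun v => hf ▸ ⟨v, rfl⟩
  have hle : ∀ s v, (f v).1 = i + s → ∃ u, (f u).1 = i ∧
      ((layerGraph L).comap f).edist u v ≤ s := by
    intro s
    induction s with
    | zero => exact fun v hv => ⟨v, hv, by simp⟩
    | succ s ih =>
      intro v hv
      have hv' := hmem v
      obtain ⟨⟨x, b⟩, hfv⟩ : ∃ y, f v = y := ⟨_, rfl⟩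
      rw [hfv] at hv hv'
      simp only at hv
      subst hv
      obtain ⟨a, ha⟩ := hL.parent (i + s) b hv'.2.2
      obtain ⟨w, hw⟩ : (i + s, a) ∈ Set.range f := by
        have := hv'.2.1
        rw [hf]
        exact ⟨by simp, by simp only at this ⊢; omega, (hL.next_mem _ _ _ ha).1⟩
      obtain ⟨u, hu, huw⟩ := ih w (by rw [hw])
      have hadj : ((layerGraph L).comap f).Adj w v := by
        rw [comap_adj, hw, hfv, layerGraph_adj]
        exact ⟨by simp, Or.inl (Or.inr ⟨rfl, ha⟩)⟩
      refine ⟨u, hu, (SimpleGraph.edist_triangle (v := w)).trans ?_⟩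
      rw [edist_eq_one_iff_adj.2 hadj, Nat.cast_succ]
      gcongr
  have hge : ∀ u v, (f u).1 = i → (((f v).1 - i : ℕ) : ℕ∞) ≤
      ((layerGraph L).comap f).edist u v := by
    intro u v hu
    refine le_iInf fun w => ?_
    have := add_length_of_lipschitz (fun x => (f x).1) (fun _ _ h => level_le_of_adj h) w.reverse
    rw [Walk.length_reverse] at this
    exact_mod_cast (by omega : (f v).1 - i ≤ w.length)
  have heq : ∀ v, (⨅ u ∈ {v | (f v).1 = i}, ((layerGraph L).comap f).edist u v) =
      (((f v).1 - i : ℕ) : ℕ∞) := by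
    intro v
    refine le_antisymm ?_ (le_iInf₂ fun u hu => hge u v hu)
    obtain ⟨u, hu, huv⟩ := hle ((f v).1 - i) v (by have := (hmem v).1; omega)
    exact (iInf₂_le u hu).trans huv
  ext v
  have := (hmem v).1
  simp only [levelSet, Set.mem_ofPred_eq]
  rw [show (⨅ u, ⨅ (_ : (f u).1 = i), ((layerGraph L).comap f).edist u v) =
    (((f v).1 - i : ℕ) : ℕ∞) from heq v, Nat.cast_inj]
  omega

/-- A repeat in a layered graph provides a repeatable graph. -/
theorem IsLayered.exists_isRepeatable (hL : IsLayered k g T L) (hg : 3 ≤ g)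
    (hr : IsRepeat g T L i p) :
    ∃ (n : ℕ) (G : SimpleGraph (Fin n)) (N0 : Set (Fin n)) (D : ℕ), IsRepeatable k g G N0 D ∧
      (⋃ i ∈ Finset.range (D - g + 1), levelSet G N0 i).ncard = segWeight L i p ∧
      D + 1 - g = p := by
  have hle := hr.le
  have hlt := hr.lt
  have hT : i + (p + g) < T := by
    rw [← hL.pos, ← add_assoc, ← hr.eq g le_rfl, hL.pos]
    omega
  obtain ⟨D, hD⟩ : ∃ D, D + 1 = p + g := ⟨p + g - 1, by omega⟩
  have := (finite_vertexSet L i (i + D)).to_subtype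
  obtain ⟨n, ⟨e⟩⟩ := Finite.exists_equiv_fin (vertexSet L i (i + D))
  obtain ⟨f, hf, hrange⟩ : ∃ f : Fin n → ℕ × ℕ, Function.Injective f ∧
      Set.range f = vertexSet L i (i + D) :=
    ⟨Subtype.val ∘ e.symm, Subtype.val_injective.comp e.symm.injective, by
      rw [EquivLike.range_comp, Subtype.range_val]⟩
  have hlev := levelSet_comap_layerGraph hL hrange
  have hmem : ∀ v, f v ∈ vertexSet L i (i + D) := fun v => hrange ▸ ⟨v, rfl⟩
  have hsurj : ∀ t a, t ≤ D → a < (L (i + t)).1 → ∃ v, f v = (i + t, a) := by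
    intro t a ht ha
    change _ ∈ Set.range f
    rw [hrange]
    exact ⟨by simp, by simpa using ht, ha⟩
  have hUnion : ∀ m s, (⋃ ℓ ∈ Finset.range m,
      levelSet ((layerGraph L).comap f) {v | (f v).1 = i} (ℓ + s)) =
      {v | i + s ≤ (f v).1 ∧ (f v).1 < i + s + m} := by
    intro m s
    ext v
    simp only [Set.mem_iUnion, hlev, Finset.mem_range, Set.mem_ofPred_eq, exists_prop]
    constructor
    · rintro ⟨ℓ, h1, h2⟩
      omega
    · rintro ⟨h1, h2⟩
      exact ⟨(f v).1 - (i + s), by omega, by omega⟩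
  have hUnion0 : ∀ m, (⋃ ℓ ∈ Finset.range m,
      levelSet ((layerGraph L).comap f) {v | (f v).1 = i} ℓ) =
      {v | i ≤ (f v).1 ∧ (f v).1 < i + m} := fun m => by simpa using hUnion m 0
  have hD' : D + 1 - g = p := by omega
  refine ⟨n, (layerGraph L).comap f, {v | (f v).1 = i}, D, ⟨?_, fun t ht => ?_,
    le_egirth_comap hL.girth hf, fun t h1 h2 v hv => ?_, fun hk => ?_, fun hk => ?_, by omega, ?_⟩,
    ?_, hD'⟩
  · obtain ⟨v, hv⟩ := hsurj D 0 le_rfl ((hL.pos _).2 (by omega))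
    refine ⟨v, ?_⟩
    rw [hlev, Set.mem_ofPred_eq, hv]
  · rw [hlev, Set.eq_empty_iff_forall_notMem]
    intro v hv
    rw [Set.mem_ofPred_eq] at hv
    have := (hmem v).2.1
    omega
  · rw [hlev, Set.mem_ofPred_eq] at hv
    rw [ncard_neighborSet_comap hf]
    · exact hL.degree _ _ (hmem v).2.2
    · intro w hw
      have h3 := level_le_of_adj hw
      have h4 := level_le_of_adj hw.symm
      rw [hrange]
      exact ⟨by omega, by omega, hL.lt_of_adj hw.symm⟩
  · rw [hlev, show {v | (f v).1 = i + 0} = f ⁻¹' vertexSet L i i by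
      ext v
      have := hmem v
      simp only [vertexSet, Set.mem_ofPred_eq, Set.mem_preimage] at this ⊢
      omega]
    refine even_finsum_comap hf (finite_vertexSet L i T) (fun x hx => ?_) (fun x hx => ?_)
      (fun x hx hx' => ?_) (fun x hx => ?_)
    · exact ⟨hx.1, hx.2.1.trans (by omega), hx.2.2⟩
    · rw [hrange]
      exact ⟨hx.1, hx.2.1.trans (by omega), hx.2.2⟩
    · rw [Set.inter_eq_left.2, hL.degree x.1 x.2 hx.2.2]
      · exact hk
      · intro w hw
        have h1 := hL.lt_of_adj hw.symm
        have h2 := level_le_of_adj hw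
        have h3 := (hL.pos w.1).1 (by omega)
        have h4 : ¬ x.1 ≤ i := fun h => hx' ⟨hx.1, h, hx.2.2⟩
        exact ⟨by omega, h3.le, h1⟩
    · rw [hrange]
      ext w
      simp only [vertexSet, Set.mem_inter_iff, mem_neighborSet, Set.mem_ofPred_eq]
      refine and_congr_right fun hw => ?_
      have h2 := level_le_of_adj hw.symm
      have h3 := hx.2.1
      omega
  · rw [hlev, show {v | (f v).1 = i + D} = f ⁻¹' vertexSet L (i + D) (i + D) by
      ext v
      have := hmem v
      simp only [vertexSet, Set.mem_ofPred_eq, Set.mem_preimage] at this ⊢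
      omega]
    refine even_finsum_comap hf (finite_vertexSet L 0 (i + D)) (fun x hx => ?_) (fun x hx => ?_)
      (fun x hx hx' => ?_) (fun x hx => ?_)
    · exact ⟨Nat.zero_le _, hx.2.1, hx.2.2⟩
    · rw [hrange]
      exact ⟨le_trans (by omega) hx.1, hx.2.1, hx.2.2⟩
    · rw [Set.inter_eq_left.2, hL.degree x.1 x.2 hx.2.2]
      · exact hk
      · intro w hw
        have h1 := hL.lt_of_adj hw.symm
        have h2 := level_le_of_adj hw.symm
        have h4 : ¬ i + D ≤ x.1 := fun h => hx' ⟨h, hx.2.1, hx.2.2⟩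
        exact ⟨Nat.zero_le _, by omega, h1⟩
    · rw [hrange]
      ext w
      simp only [vertexSet, Set.mem_inter_iff, mem_neighborSet, Set.mem_ofPred_eq]
      refine and_congr_right fun hw => ?_
      have h2 := level_le_of_adj hw
      have h3 := hx.1
      omega
  · rw [hD', hUnion0, hUnion]
    have hex : ∀ v, (f v).1 < i + g → ∃ w, f w = ((f v).1 + p, (f v).2) := by
      intro v hv
      have h1 := hmem v
      obtain ⟨t, ht⟩ := Nat.exists_eq_add_of_le h1.1
      obtain ⟨w, hw⟩ := hsurj (p + t) (f v).2 (by omega) (by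
        have := h1.2.2
        rwa [ht, hr.eq t (by omega), add_assoc] at this)
      refine ⟨w, ?_⟩
      rw [hw, ht]
      congr 1
      ring
    choose! σ hσ using hex
    have hbij : Set.BijOn σ {v | i ≤ (f v).1 ∧ (f v).1 < i + g}
        {v | i + p ≤ (f v).1 ∧ (f v).1 < i + p + g} := by
      refine ⟨fun v hv => ?_, fun u hu v hv huv => hf ?_, fun w hw => ?_⟩
      · simp only [Set.mem_ofPred_eq] at hv ⊢
        rw [hσ v hv.2]
        omega
      · have h1 := hσ u hu.2
        rw [huv, hσ v hv.2, Prod.mk.injEq] at h1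
        exact Prod.ext (by omega) h1.2.symm
      · simp only [Set.mem_ofPred_eq] at hw
        obtain ⟨t, ht⟩ := Nat.exists_eq_add_of_le hw.1
        obtain ⟨v, hv⟩ := hsurj t (f w).2 (by omega) (by
          have := (hmem w).2.2
          rwa [ht, ← hr.eq t (by omega)] at this)
        have hv1 : (f v).1 = i + t := by rw [hv]
        refine ⟨v, ⟨by omega, by omega⟩, hf ?_⟩
        rw [hσ v (by omega), hv]
        exact Prod.ext (by simp only; omega) rfl
    obtain ⟨φ, hφ⟩ := exists_induce_iso (G := (layerGraph L).comap f) hbij (by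
      intro u hu v hv
      obtain ⟨s, hs⟩ := Nat.exists_eq_add_of_le hu.1
      obtain ⟨t, ht⟩ := Nat.exists_eq_add_of_le hv.1
      have h1 := hu.2
      have h2 := hv.2
      rw [comap_adj, comap_adj, hσ u h1, hσ v h2, hs, ht, add_right_comm, add_right_comm i t,
        ← layerGraph_adj_shift hr.eq (by omega) (by omega), ← hs, ← ht])
    refine ⟨φ, fun x ℓ hℓ hx => ?_⟩
    rw [hlev, Set.mem_ofPred_eq] at hx ⊢
    rw [hφ, hσ _ (by omega), hx]
    ring
  · rw [show D - g + 1 = p by omega, hUnion0, ← Set.ncard_image_of_injective _ hf]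
    obtain ⟨q, rfl⟩ : ∃ q, p = q + 1 := ⟨p - 1, by omega⟩
    rw [← ncard_vertexSet]
    congr 1
    ext x
    constructor
    · rintro ⟨v, hv, rfl⟩
      have h1 := hv.2
      exact ⟨hv.1, by omega, (hmem v).2.2⟩
    · rintro ⟨h1, h2, h3⟩
      obtain ⟨t, ht⟩ := Nat.exists_eq_add_of_le h1
      obtain ⟨v, hv⟩ := hsurj t x.2 (by omega) (ht ▸ h3)
      rw [← ht] at hv
      exact ⟨v, ⟨by rw [hv]; exact h1, by rw [hv]; simp only; omega⟩, hv⟩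

end Repeatable

section Assembly

variable {V W : Type*} {k g d T : ℕ} {L : ℕ → Layer} {i p : ℕ}

theorem edist_map_le {G : SimpleGraph V} {H : SimpleGraph W} (f : G →g H) (u v : V) :
    H.edist (f u) (f v) ≤ G.edist u v :=
  le_iInf fun w => (edist_le (w.map f)).trans (by rw [Walk.length_map])

theorem ediam_le_of_iso {G : SimpleGraph V} {H : SimpleGraph W} (f : G ≃g H) :
    H.ediam ≤ G.ediam := by
  refine ediam_le_of_edist_le fun u v => ?_
  have : H.edist (f (f.symm u)) (f (f.symm v)) ≤ G.edist (f.symm u) (f.symm v) :=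
    edist_map_le (f : G →g H) _ _
  rw [f.apply_symm_apply, f.apply_symm_apply] at this
  exact this.trans edist_le_ediam

theorem IsKGDGraph.exists_fin [Finite V] {G : SimpleGraph V} (hG : IsKGDGraph k g d G) :
    ∃ H : SimpleGraph (Fin (Nat.card V)), IsKGDGraph k g d H := by
  let e := (Finite.equivFin V).symm
  let φ : G.comap e ≃g G := Iso.comap e G
  refine ⟨G.comap e, fun v => ?_, ?_, ?_⟩
  · rw [ncard_neighborSet_comap e.injective, hG.1]
    rw [e.range_eq_univ]
    exact Set.subset_univ _
  · rw [φ.egirth_eq, hG.2.1]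
  · rw [← hG.2.2]
    exact le_antisymm (ediam_le_of_iso φ.symm) (ediam_le_of_iso φ)

theorem exists_eccent [Finite V] (G : SimpleGraph V) (u : V) :
    ∃ e, (∀ v, G.dist u v ≤ e) ∧ ∃ v, G.dist u v = e := by
  have : Nonempty V := ⟨u⟩
  obtain ⟨v, hv⟩ := Finite.exists_max (G.dist u)
  exact ⟨_, hv, v, rfl⟩

theorem exists_diam [Finite V] [Nonempty V] (G : SimpleGraph V) :
    ∃ a e, (∀ u v, G.dist u v ≤ e) ∧ ∃ b, G.dist a b = e := by
  obtain ⟨⟨a, b⟩, h⟩ := Finite.exists_max fun x : V × V => G.dist x.1 x.2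
  exact ⟨a, _, fun u v => h (u, v), b, rfl⟩

theorem exists_layered_family (hk : 3 ≤ k) (hg : 3 ≤ g) :
    ∃ a C : ℕ, ∀ T₀, ∃ T, T₀ ≤ T ∧ ∃ L, IsLayered k g T L ∧ weight L T ≤ a * T + C := by
  obtain ⟨c, C, t₀, h⟩ := exists_connected_regular_linear hk hg
  refine ⟨c, C, fun T₀ => ?_⟩
  obtain ⟨V, _, G, hG, hreg, hgirth, hcard, u, v, huv⟩ := h (T₀ + t₀) (by omega)
  obtain ⟨e, he, hex⟩ := exists_eccent G u
  obtain ⟨L, hL, hw⟩ := exists_isLayered_of_connected hG hreg hgirth he hex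
  have hev := he v
  obtain ⟨s, rfl⟩ : ∃ s, T₀ + t₀ + s = e := ⟨e - (T₀ + t₀), by omega⟩
  refine ⟨T₀ + t₀ + s + 1, by omega, L, hL, ?_⟩
  rw [hw]
  refine hcard.trans (Nat.add_le_add_right (Nat.mul_le_mul_left _ ?_) _)
  omega

/-- A lower bound for layered graphs applies to all graphs with given diameter. -/
theorem IsKGDGraph.mul_le {w C : ℕ}
    (h : ∀ (T : ℕ) (L : ℕ → Layer), IsLayered k g T L → w * T ≤ p * (weight L T + C))
    {n : ℕ} {G : SimpleGraph (Fin n)} (hG : IsKGDGraph k g d G) : w * (d + 1) ≤ p * (n + C) := by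
  obtain ⟨hreg, hgirth, hdiam⟩ := hG
  have hne : Nonempty (Fin n) := by
    by_contra hne
    rw [not_nonempty_iff] at hne
    have : G.egirth = ⊤ := egirth_eq_top.2 fun v => isEmptyElim v
    rw [this] at hgirth
    exact ENat.natCast_ne_top g hgirth.symm
  have hne' : G.ediam ≠ ⊤ := by
    rw [hdiam]
    exact ENat.natCast_ne_top d
  have hdiam' : G.diam = d := by rw [diam, hdiam, ENat.toNat_natCast]
  obtain ⟨u, v, huv⟩ := G.exists_dist_eq_diam
  obtain ⟨L, hL, hw⟩ := exists_isLayered_of_connected (connected_of_ediam_ne_top hne') hreg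
    hgirth.ge (u := u) (fun v => (dist_le_diam hne').trans_eq hdiam') ⟨v, huv.trans hdiam'⟩
  have := h _ _ hL
  rwa [hw, Nat.card_fin] at this

/-- Pumping a repeat and attaching tails produces graphs of all large diameters. -/
theorem IsLayered.exists_isKGDGraph (hk : 3 ≤ k) (hg : 3 ≤ g) (hL : IsLayered k g T L)
    (hr : IsRepeat g T L i p) {C : ℕ}
    (h : ∀ (T' : ℕ) (L' : ℕ → Layer), IsLayered k g T' L' →
      segWeight L i p * T' ≤ p * (weight L' T' + C)) :
    ∃ C' d₀ : ℕ, ∀ d, d₀ ≤ d → ∃ n, p * n ≤ segWeight L i p * d + p * C' ∧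
      ∃ G : SimpleGraph (Fin n), IsKGDGraph k g d G := by
  obtain ⟨t₀, c, htail⟩ := exists_isTail_of_le hk hg
  have hp := hr.le
  have hlt := hr.lt
  have hwpos : 0 < segWeight L i p :=
    ((hL.pos (i + 0)).2 (by omega)).trans_le (le_segWeight L i (by omega))
  obtain ⟨K, hK⟩ : ∃ K, K = p * (weight L T + C) := ⟨_, rfl⟩
  obtain ⟨B, hB⟩ : ∃ B, B = K + t₀ + 3 + p := ⟨_, rfl⟩
  refine ⟨weight L T + c * (B + 1), 2 * B, fun d hd => ?_⟩
  obtain ⟨m, hm⟩ : ∃ m, m = (d - (K + t₀ + 3)) / p := ⟨_, rfl⟩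
  have hm1 : m * p ≤ d - (K + t₀ + 3) := hm ▸ Nat.div_mul_le_self _ _
  have hm2 : d - (K + t₀ + 3) < m * p + p := hm ▸ Nat.lt_div_mul_add (by omega)
  obtain ⟨L', hL', hw'⟩ := hL.pump_iterate hg hr m
  obtain ⟨q, hq⟩ : ∃ q, T + m * p = q + 1 := ⟨T + m * p - 1, by omega⟩
  rw [hq] at hL' hw'
  obtain ⟨V, _, S, hS, hSk, hSg, hcard, u, v, huv⟩ := hL'.exists_connected
  have : Nonempty V := ⟨u⟩
  obtain ⟨a, e, hle, b, hab⟩ := exists_diam S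
  obtain ⟨L₁, hL₁, hw₁⟩ := exists_isLayered_of_connected hS hSk hSg (hle a) ⟨b, hab⟩
  have he1 := hle u v
  have he2 : e ≤ m * p + K := by
    have h1 := h _ _ hL₁
    rw [hw₁, hcard, hw'] at h1
    by_contra! hcon
    have h2 : segWeight L i p * (m * p + K) + segWeight L i p ≤ segWeight L i p * (e + 1) := by
      rw [← Nat.mul_succ]
      gcongr
      omega
    have h3 : K ≤ segWeight L i p * K := Nat.le_mul_of_pos_left _ hwpos
    have h4 : p * (weight L T + m * segWeight L i p + C) = K + segWeight L i p * (m * p) := by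
      rw [hK]
      ring
    rw [mul_add] at h2
    omega
  obtain ⟨E, hE1, hE2, hE⟩ := exists_attach_isKGDGraph hk hS hSk hSg hle ⟨a, b, hab⟩
  obtain ⟨t, ht⟩ : ∃ t, d = E + t := ⟨d - E, by omega⟩
  obtain ⟨W, _, R, ρ, hR, hRcard⟩ := htail t (by omega)
  obtain ⟨G, hG⟩ := hE t W inferInstance R ρ hR (by omega) (by omega)
  obtain ⟨H, hH⟩ := hG.exists_fin
  refine ⟨_, ?_, H, ht ▸ hH⟩
  rw [Nat.card_sum, hcard, hw']
  calc p * (weight L T + m * segWeight L i p + Nat.card W)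
      = segWeight L i p * (m * p) + p * (weight L T + Nat.card W) := by ring
    _ ≤ segWeight L i p * d + p * (weight L T + c * (B + 1)) := by
      gcongr
      · omega
      · refine hRcard.trans ?_
        gcongr
        omega

theorem fRatio_eq_of_bounds {w : ℕ} (hp : 0 < p)
    (hlow : ∃ C : ℕ, ∀ (d n : ℕ) (G : SimpleGraph (Fin n)), IsKGDGraph k g d G →
      w * (d + 1) ≤ p * (n + C))
    (hup : ∃ C d₀ : ℕ, ∀ d, d₀ ≤ d → ∃ n, p * n ≤ w * d + p * C ∧
      ∃ G : SimpleGraph (Fin n), IsKGDGraph k g d G) : fRatio k g = (w : ℝ) / p := by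
  have hp' : (0 : ℝ) < p := Nat.cast_pos.2 hp
  refine IsLeast.csInf_eq ⟨?_, ?_⟩
  · obtain ⟨C, d₀, h⟩ := hup
    refine ⟨C, d₀, fun d hd => ?_⟩
    obtain ⟨n, hn, hG⟩ := h d hd
    refine ⟨n, ?_, hG⟩
    rw [div_mul_eq_mul_div, div_add' _ _ _ hp'.ne', le_div_iff₀ hp']
    have : (p * n : ℝ) ≤ w * d + p * C := by exact_mod_cast hn
    linarith
  · rintro c ⟨C, d₀, h⟩
    obtain ⟨C', hlow⟩ := hlow
    rw [div_le_iff₀ hp']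
    by_contra! hcon
    obtain ⟨m, hm⟩ := exists_nat_gt (p * (C + C') / (w - c * p))
    rw [div_lt_iff₀ (by linarith)] at hm
    obtain ⟨n, hn, G, hG⟩ := h (m + d₀) (by omega)
    have h1 : (w * ((m + d₀ : ℕ) + 1) : ℝ) ≤ p * (n + C') := by exact_mod_cast hlow _ n G hG
    have h2 : (p * n : ℝ) ≤ p * (c * (m + d₀ : ℕ) + C) := by gcongr
    push_cast at h1 h2
    have h3 : (0 : ℝ) ≤ (w - c * p) * d₀ := mul_nonneg (by linarith) (Nat.cast_nonneg _)
    have h4 : (0 : ℝ) ≤ w := Nat.cast_nonneg _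
    nlinarith

end Assembly

theorem fRatio_attained_by_repeatable (k g : ℕ) (hk : 3 ≤ k) (hg : 3 ≤ g) :
    (∃ (n : ℕ) (G : SimpleGraph (Fin n)) (N0 : Set (Fin n)) (D : ℕ),
      IsRepeatable k g G N0 D ∧
      fRatio k g =
        ((⋃ i ∈ Finset.range (D - g + 1), levelSet G N0 i).ncard : ℝ) / (D + 1 - g : ℕ)) ∧
    ∃ q : ℚ, fRatio k g = (q : ℝ) := by
  obtain ⟨T, L, i, p, hL, hr, C, hC⟩ := exists_optimal_isRepeat hg (exists_layered_family hk hg)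
  obtain ⟨n, G, N0, D, hG, hcard, hD⟩ := hL.exists_isRepeatable hg hr
  have hf : fRatio k g = (segWeight L i p : ℝ) / p :=
    fRatio_eq_of_bounds (by have := hr.le; omega) ⟨C, fun _ _ _ hH => hH.mul_le hC⟩
      (hL.exists_isKGDGraph hk hg hr hC)
  refine ⟨⟨n, G, N0, D, hG, ?_⟩, segWeight L i p / p, ?_⟩
  · rw [hcard, hD, hf]
  · rw [hf]
    push_cast
    rfl
end

section
/- Let d ≥ 5 be an integer, written uniquely as d = 5 + 4q + j with integers q ≥ 0 and 0 ≤ j ≤ 3. Then n(3;4,d) = 14 + 2j + 6q; that is, there exists a 3-regular simple graph of girth exactly 4 and diameter exactly d with 14 + 2j + 6q vertices, and every such graph has at least 14 + 2j + 6q vertices. -/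
namespace SimpleGraph

variable {V W : Type*} {G : SimpleGraph V} {H : SimpleGraph W}

/-- No two vertices that are joined by a path of length two are adjacent. -/
def TriangleFree (G : SimpleGraph V) : Prop :=
  ∀ a b c, G.Adj a b → G.Adj b c → ¬ G.Adj a c

lemma triangleFree_iff_four_le_egirth : G.TriangleFree ↔ 4 ≤ G.egirth := by
  classical
  constructor
  · intro h
    rw [le_egirth]
    intro a w hw
    have h3 := hw.three_le_length
    by_contra! hlt
    have hlt' : w.length < 4 := by exact_mod_cast hlt
    obtain ⟨s, hs⟩ := is3Clique_iff_exists_cycle_length_three.2 ⟨a, w, hw, by omega⟩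
    obtain ⟨x, y, z, hxy, hxz, hyz, -⟩ := is3Clique_iff.1 hs
    exact h x y z hxy hyz hxz
  · intro h a b c hab hbc hac
    obtain ⟨u, w, hw, hlen⟩ := is3Clique_iff_exists_cycle_length_three.1
      ⟨{a, b, c}, is3Clique_iff.2 ⟨a, b, c, hab, hac, hbc, rfl⟩⟩
    have := h.trans (egirth_le_length hw)
    rw [hlen] at this
    norm_cast at this

/-! ### Joining two graphs by a bridge -/

/-- The disjoint union of `G` and `H` together with an edge from `r` to `s`. -/
def bridge (G : SimpleGraph V) (r : V) (H : SimpleGraph W) (s : W) : SimpleGraph (V ⊕ W) where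
  Adj
    | .inl a, .inl b => G.Adj a b
    | .inr a, .inr b => H.Adj a b
    | .inl a, .inr b => a = r ∧ b = s
    | .inr b, .inl a => a = r ∧ b = s
  symm := ⟨by rintro (a | a) (b | b) h <;> first | exact h.symm | exact h⟩
  loopless := ⟨by rintro (a | a) h <;> exact h.ne rfl⟩

section bridge

variable {r : V} {s : W}

@[simp] lemma bridge_adj_inl_inl {a b : V} :
    (bridge G r H s).Adj (.inl a) (.inl b) ↔ G.Adj a b := Iff.rfl

@[simp] lemma bridge_adj_inr_inr {a b : W} :
    (bridge G r H s).Adj (.inr a) (.inr b) ↔ H.Adj a b := Iff.rfl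

@[simp] lemma bridge_adj_inl_inr {a : V} {b : W} :
    (bridge G r H s).Adj (.inl a) (.inr b) ↔ a = r ∧ b = s := Iff.rfl

@[simp] lemma bridge_adj_inr_inl {a : V} {b : W} :
    (bridge G r H s).Adj (.inr b) (.inl a) ↔ a = r ∧ b = s := Iff.rfl

lemma TriangleFree.bridge (hG : G.TriangleFree) (hH : H.TriangleFree) :
    (bridge G r H s).TriangleFree := by
  rintro (a | a) (b | b) (c | c) h₁ h₂ h₃ <;>
    simp only [bridge_adj_inl_inl, bridge_adj_inr_inr, bridge_adj_inl_inr,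
      bridge_adj_inr_inl] at h₁ h₂ h₃
  · exact hG a b c h₁ h₂ h₃
  · exact h₁.ne (h₃.1.trans h₂.1.symm)
  · exact h₃.ne (h₁.1.trans h₂.1.symm)
  · exact h₂.ne (h₁.2.trans h₃.2.symm)
  · exact h₂.ne (h₁.1.trans h₃.1.symm)
  · exact h₃.ne (h₁.2.trans h₂.2.symm)
  · exact h₁.ne (h₃.2.trans h₂.2.symm)
  · exact hH a b c h₁ h₂ h₃

lemma ncard_neighborSet_bridge_inl {v : V} (hv : v ≠ r) :
    ((bridge G r H s).neighborSet (.inl v)).ncard = (G.neighborSet v).ncard := by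
  rw [← Set.ncard_image_of_injective _ (Sum.inl_injective (α := V) (β := W))]
  congr 1
  ext (w | w) <;> simp [hv]

lemma ncard_neighborSet_bridge_inl_self [Finite V] :
    ((bridge G r H s).neighborSet (.inl r)).ncard = (G.neighborSet r).ncard + 1 := by
  rw [← Set.ncard_image_of_injective _ (Sum.inl_injective (α := V) (β := W)),
    ← Set.ncard_insert_of_notMem (a := Sum.inr s) (by simp)]
  congr 1
  ext (w | w) <;> simp

lemma ncard_neighborSet_bridge_inr {w : W} (hw : w ≠ s) :
    ((bridge G r H s).neighborSet (.inr w)).ncard = (H.neighborSet w).ncard := by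
  rw [← Set.ncard_image_of_injective _ (Sum.inr_injective (α := V) (β := W))]
  congr 1
  ext (v | v) <;> simp [hw]

lemma ncard_neighborSet_bridge_inr_self [Finite W] :
    ((bridge G r H s).neighborSet (.inr s)).ncard = (H.neighborSet s).ncard + 1 := by
  rw [← Set.ncard_image_of_injective _ (Sum.inr_injective (α := V) (β := W)),
    ← Set.ncard_insert_of_notMem (a := Sum.inl r) (by simp)]
  congr 1
  ext (v | v) <;> simp

/-- The inclusion of the left side of a bridge. -/
def bridgeInl (G : SimpleGraph V) (r : V) (H : SimpleGraph W) (s : W) : G →g bridge G r H s :=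
  ⟨Sum.inl, id⟩

/-- The inclusion of the right side of a bridge. -/
def bridgeInr (G : SimpleGraph V) (r : V) (H : SimpleGraph W) (s : W) : H →g bridge G r H s :=
  ⟨Sum.inr, id⟩

lemma exists_walk_bridge_inl {k : ℕ} {a b : V} (h : ∃ p : G.Walk a b, p.length ≤ k) :
    ∃ p : (bridge G r H s).Walk (.inl a) (.inl b), p.length ≤ k :=
  let ⟨p, hp⟩ := h
  ⟨p.map (bridgeInl G r H s), (p.length_map _).trans_le hp⟩

lemma exists_walk_bridge_inr {k : ℕ} {a b : W} (h : ∃ p : H.Walk a b, p.length ≤ k) :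
    ∃ p : (bridge G r H s).Walk (.inr a) (.inr b), p.length ≤ k :=
  let ⟨p, hp⟩ := h
  ⟨p.map (bridgeInr G r H s), (p.length_map _).trans_le hp⟩

end bridge

lemma exists_walk_symm {k : ℕ} {a b : V} (h : ∃ p : G.Walk a b, p.length ≤ k) :
    ∃ p : G.Walk b a, p.length ≤ k :=
  let ⟨p, hp⟩ := h
  ⟨p.reverse, p.length_reverse.trans_le hp⟩

lemma exists_walk_trans {k l m : ℕ} {a b c : V} (h₁ : ∃ p : G.Walk a b, p.length ≤ k)
    (h₂ : ∃ p : G.Walk b c, p.length ≤ l) (hm : k + l ≤ m) :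
    ∃ p : G.Walk a c, p.length ≤ m := by
  obtain ⟨p, hp⟩ := h₁
  obtain ⟨q, hq⟩ := h₂
  exact ⟨p.append q, by rw [Walk.length_append]; omega⟩

lemma exists_walk_bridge_cross {k l m : ℕ} {r a : V} {s b : W}
    (h₁ : ∃ p : G.Walk a r, p.length ≤ k) (h₂ : ∃ p : H.Walk b s, p.length ≤ l)
    (hm : k + 1 + l ≤ m) :
    ∃ p : (bridge G r H s).Walk (.inl a) (.inr b), p.length ≤ m := by
  have hrs : (bridge G r H s).Adj (.inl r) (.inr s) := ⟨rfl, rfl⟩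
  refine exists_walk_trans (exists_walk_trans (exists_walk_bridge_inl h₁) ⟨hrs.toWalk, le_refl 1⟩
    le_rfl) (exists_walk_bridge_inr (exists_walk_symm h₂)) hm

/-- A function that can be decreased along an edge everywhere except at `c` bounds the
distance to `c`. -/
lemma exists_walk_of_descent {c : V} (h : V → ℕ) (hd : ∀ v, v ≠ c → ∃ w, G.Adj v w ∧ h w < h v)
    (v : V) : ∃ p : G.Walk v c, p.length ≤ h v := by
  induction hn : h v using Nat.strong_induction_on generalizing v with
  | _ n ih =>
    by_cases hv : v = c
    · subst hv
      exact ⟨.nil, Nat.zero_le _⟩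
    · obtain ⟨w, hvw, hw⟩ := hd v hv
      obtain ⟨p, hp⟩ := ih (h w) (hn ▸ hw) w rfl
      exact ⟨.cons hvw p, by rw [Walk.length_cons]; omega⟩

/-- A function that grows by at most one along each edge bounds lengths of walks from below. -/
lemma Walk.le_add_length_of_lipschitz {h : V → ℕ} (hl : ∀ u v, G.Adj u v → h u ≤ h v + 1)
    {u v : V} (p : G.Walk u v) : h u ≤ h v + p.length := by
  induction p with
  | nil => simp
  | cons huv p ih =>
    have := hl _ _ huv
    rw [Walk.length_cons]
    omega

/-! ### Rooted cubic graphs -/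

/-- A triangle-free graph in which all degrees are `3`, except that the root has degree `2`;
the root has eccentricity `e` and the diameter is at most `e + 3`. -/
structure IsRootedCubic (G : SimpleGraph V) (r : V) (e : ℕ) : Prop where
  ncard_of_ne : ∀ v, v ≠ r → (G.neighborSet v).ncard = 3
  ncard_root : (G.neighborSet r).ncard = 2
  triangleFree : G.TriangleFree
  exists_walk_root : ∀ v, ∃ p : G.Walk v r, p.length ≤ e
  exists_walk : ∀ u v, ∃ p : G.Walk u v, p.length ≤ e + 3
  exists_height : ∃ h : V → ℕ, h r = 0 ∧ (∀ u v, G.Adj u v → h u ≤ h v + 1) ∧ ∃ x, h x = e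

lemma ncard_neighborSet_eq_card_filter [Fintype V] [DecidableRel G.Adj] (v : V) :
    (G.neighborSet v).ncard = (Finset.univ.filter (G.Adj v)).card := by
  rw [← Set.ncard_coe_finset]
  congr 1
  ext w
  simp

lemma isRootedCubic_of_heights [Fintype V] [DecidableRel G.Adj] {r : V} {e : ℕ}
    (h3 : ∀ v, v ≠ r → (Finset.univ.filter (G.Adj v)).card = 3)
    (h2 : (Finset.univ.filter (G.Adj r)).card = 2)
    (htri : ∀ a b, G.Adj a b → ∀ c, G.Adj b c → ¬ G.Adj a c)
    (h : V → ℕ) (hr : h r = 0) (hd : ∀ v, v ≠ r → ∃ w, G.Adj v w ∧ h w < h v)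
    (hl : ∀ u v, G.Adj u v → h u ≤ h v + 1) (hx : ∃ x, h x = e) (he : ∀ v, h v ≤ e)
    (c : V) (k : V → ℕ) (hk : ∀ v, v ≠ c → ∃ w, G.Adj v w ∧ k w < k v)
    (hke : ∀ v, 2 * k v ≤ e + 3) : G.IsRootedCubic r e where
  ncard_of_ne v hv := by rw [ncard_neighborSet_eq_card_filter, h3 v hv]
  ncard_root := by rw [ncard_neighborSet_eq_card_filter, h2]
  triangleFree a b c hab hbc := htri a b hab c hbc
  exists_walk_root v := by
    obtain ⟨p, hp⟩ := exists_walk_of_descent h hd v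
    exact ⟨p, hp.trans (he v)⟩
  exists_walk u v := by
    refine exists_walk_trans (exists_walk_of_descent k hk u)
      (exists_walk_symm (exists_walk_of_descent k hk v)) ?_
    have := hke u
    have := hke v
    omega
  exists_height := ⟨h, hr, hl, hx⟩

/-- The graph on `Fin n` in which `u` is joined to all the members of `t u`. -/
abbrev ofTable {n : ℕ} (t : Fin n → Finset (Fin n)) : SimpleGraph (Fin n) :=
  fromRel fun u v => v ∈ t u

/-- A rooted cubic graph with `7` vertices and eccentricity `2`. -/
abbrev rooted7 : SimpleGraph (Fin 7) :=
  ofTable ![{1, 2}, {3, 4}, {5, 6}, {5, 6}, {5, 6}, ∅, ∅]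

/-- A rooted cubic graph with `9` vertices and eccentricity `3`. -/
abbrev rooted9 : SimpleGraph (Fin 9) :=
  ofTable ![{1, 2}, {3, 4}, {5, 6}, {5, 7}, {7, 8}, {8}, {7, 8}, ∅, ∅]

/-- A rooted cubic graph with `11` vertices and eccentricity `4`. -/
abbrev rooted11 : SimpleGraph (Fin 11) :=
  ofTable ![{1, 2}, {3, 4}, {3, 4}, {5}, {6}, {9, 10}, {7, 8}, {9, 10}, {9, 10}, ∅, ∅]

/-- A rooted cubic graph with `13` vertices and eccentricity `5`. -/
abbrev rooted13 : SimpleGraph (Fin 13) :=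
  ofTable ![{1, 2}, {3, 4}, {3, 4}, {5}, {6}, {6, 7}, {8}, {11, 12}, {9, 10}, {11, 12}, {11, 12},
    ∅, ∅]

lemma isRootedCubic_rooted7 : rooted7.IsRootedCubic 0 2 :=
  isRootedCubic_of_heights (by decide) (by decide) (by decide)
    ![0, 1, 1, 2, 2, 2, 2] (by decide) (by decide) (by decide) (by decide) (by decide)
    0 ![0, 1, 1, 2, 2, 2, 2] (by decide) (by decide)

lemma isRootedCubic_rooted9 : rooted9.IsRootedCubic 0 3 :=
  isRootedCubic_of_heights (by decide) (by decide) (by decide)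
    ![0, 1, 1, 2, 2, 2, 2, 3, 3] (by decide) (by decide) (by decide) (by decide) (by decide)
    0 ![0, 1, 1, 2, 2, 2, 2, 3, 3] (by decide) (by decide)

set_option maxRecDepth 4000 in
lemma isRootedCubic_rooted11 : rooted11.IsRootedCubic 0 4 :=
  isRootedCubic_of_heights (by decide) (by decide) (by decide)
    ![0, 1, 1, 2, 2, 3, 3, 4, 4, 4, 4] (by decide) (by decide) (by decide) (by decide) (by decide)
    3 ![2, 1, 1, 0, 2, 1, 3, 3, 3, 2, 2] (by decide) (by decide)

set_option maxRecDepth 4000 in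
lemma isRootedCubic_rooted13 : rooted13.IsRootedCubic 0 5 :=
  isRootedCubic_of_heights (by decide) (by decide) (by decide)
    ![0, 1, 1, 2, 2, 3, 3, 4, 4, 5, 5, 5, 5] (by decide) (by decide) (by decide) (by decide)
    (by decide)
    5 ![3, 2, 2, 1, 2, 0, 1, 1, 2, 3, 3, 2, 2] (by decide) (by decide)

/-- The complete bipartite graph `K₃,₃` minus the edge joining `0` and `5`. -/
abbrev gadget : SimpleGraph (Fin 6) :=
  ofTable ![{1, 2}, {3, 4}, {3, 4}, {5}, {5}, ∅]

lemma gadget_triangleFree : gadget.TriangleFree := by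
  have : ∀ a b, gadget.Adj a b → ∀ c, gadget.Adj b c → ¬ gadget.Adj a c := by decide
  exact fun a b c hab hbc => this a b hab c hbc

lemma gadget_walk_zero (v : Fin 6) : ∃ p : gadget.Walk v 0, p.length ≤ 3 := by
  obtain ⟨p, hp⟩ := exists_walk_of_descent (G := gadget) (c := 0) ![0, 1, 1, 2, 2, 3]
    (by decide) v
  exact ⟨p, hp.trans (by clear hp p; revert v; decide)⟩

lemma gadget_walk_five (v : Fin 6) : ∃ p : gadget.Walk v 5, p.length ≤ 3 := by
  obtain ⟨p, hp⟩ := exists_walk_of_descent (G := gadget) (c := 5) ![3, 2, 2, 1, 1, 0]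
    (by decide) v
  exact ⟨p, hp.trans (by clear hp p; revert v; decide)⟩

lemma ncard_neighborSet_gadget (v : Fin 6) :
    (gadget.neighborSet v).ncard = if v = 0 ∨ v = 5 then 2 else 3 := by
  rw [ncard_neighborSet_eq_card_filter]
  revert v
  decide

/-- Attaching the gadget to the root increases the eccentricity by `4`. -/
lemma IsRootedCubic.bridge_gadget [Finite V] {r : V} {e : ℕ} (hG : G.IsRootedCubic r e) :
    (bridge G r gadget 0).IsRootedCubic (.inr 5) (e + 4) where
  ncard_of_ne := by
    rintro (v | v) hv
    · by_cases hvr : v = r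
      · rw [hvr, ncard_neighborSet_bridge_inl_self, hG.ncard_root]
      · rw [ncard_neighborSet_bridge_inl hvr, hG.ncard_of_ne v hvr]
    · have hv5 : v ≠ 5 := fun h => hv (congrArg _ h)
      by_cases hv0 : v = 0
      · rw [hv0, ncard_neighborSet_bridge_inr_self, ncard_neighborSet_gadget, if_pos (by simp)]
      · rw [ncard_neighborSet_bridge_inr hv0, ncard_neighborSet_gadget, if_neg (by simp [*])]
  ncard_root := by
    rw [ncard_neighborSet_bridge_inr (by decide), ncard_neighborSet_gadget, if_pos (by simp)]
  triangleFree := hG.triangleFree.bridge gadget_triangleFree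
  exists_walk_root := by
    rintro (v | v)
    · exact exists_walk_bridge_cross (hG.exists_walk_root v) (gadget_walk_zero 5) le_rfl
    · obtain ⟨p, hp⟩ := exists_walk_bridge_inr (G := G) (r := r) (s := 0) (gadget_walk_five v)
      exact ⟨p, by omega⟩
  exists_walk := by
    rintro (u | u) (v | v)
    · obtain ⟨p, hp⟩ := exists_walk_bridge_inl (H := gadget) (r := r) (s := 0)
        (hG.exists_walk u v)
      exact ⟨p, by omega⟩
    · exact exists_walk_bridge_cross (hG.exists_walk_root u) (gadget_walk_zero v) (by omega)
    · exact exists_walk_symm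
        (exists_walk_bridge_cross (hG.exists_walk_root v) (gadget_walk_zero u) (by omega))
    · exact exists_walk_bridge_inr (exists_walk_trans (gadget_walk_zero u)
        (exists_walk_symm (gadget_walk_zero v)) (by omega))
  exists_height := by
    obtain ⟨h, hr, hl, x, hx⟩ := hG.exists_height
    refine ⟨Sum.elim (fun v => h v + 4) ![3, 2, 2, 1, 1, 0], rfl, ?_, .inl x, by simp [hx]⟩
    have hgadget : ∀ u v, gadget.Adj u v →
        (![3, 2, 2, 1, 1, 0] : Fin 6 → ℕ) u ≤ (![3, 2, 2, 1, 1, 0] : Fin 6 → ℕ) v + 1 := by decide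
    rintro (u | u) (v | v) huv
    · have := hl u v huv
      simp only [Sum.elim_inl]
      omega
    · obtain ⟨rfl, rfl⟩ := huv
      simp [hr]
    · obtain ⟨rfl, rfl⟩ := huv
      simp
    · exact hgadget u v huv

/-- Attaching `rooted7` to the root gives a cubic graph. -/
lemma IsRootedCubic.isKGDGraph_bridge [Finite V] {r : V} {e : ℕ} (hG : G.IsRootedCubic r e)
    (he : 1 ≤ e) : IsKGDGraph 3 4 (e + 3) (bridge G r rooted7 0) := by
  have h7 := isRootedCubic_rooted7
  refine ⟨?_, le_antisymm ?_ ?_, le_antisymm ?_ ?_⟩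
  · rintro (v | v)
    · by_cases hv : v = r
      · rw [hv, ncard_neighborSet_bridge_inl_self, hG.ncard_root]
      · rw [ncard_neighborSet_bridge_inl hv, hG.ncard_of_ne v hv]
    · by_cases hv : v = 0
      · rw [hv, ncard_neighborSet_bridge_inr_self, h7.ncard_root]
      · rw [ncard_neighborSet_bridge_inr hv, h7.ncard_of_ne v hv]
  · have h35 : rooted7.Adj 3 5 := by decide
    have h54 : rooted7.Adj 5 4 := by decide
    have h46 : rooted7.Adj 4 6 := by decide
    have h63 : rooted7.Adj 6 3 := by decide
    let c : rooted7.Walk 3 3 := .cons h35 (.cons h54 (.cons h46 (.cons h63 .nil)))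
    have hc : c.IsCycle := by
      simp [c, Walk.isCycle_def, Walk.isTrail_def]
    have hinj : Function.Injective (bridgeInr G r rooted7 0) := Sum.inr_injective
    exact egirth_le_length ((Walk.isCycle_map_iff_of_injective hinj).2 hc)
  · exact triangleFree_iff_four_le_egirth.1 (hG.triangleFree.bridge h7.triangleFree)
  · refine ediam_le_of_edist_le fun u v => ?_
    suffices h : ∃ p : (bridge G r rooted7 0).Walk u v, p.length ≤ e + 3 by
      obtain ⟨p, hp⟩ := h
      exact (edist_le p).trans (by exact_mod_cast hp)
    rcases u with u | u <;> rcases v with v | v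
    · exact exists_walk_bridge_inl (hG.exists_walk u v)
    · exact exists_walk_bridge_cross (hG.exists_walk_root u) (h7.exists_walk_root v) (by omega)
    · exact exists_walk_symm
        (exists_walk_bridge_cross (hG.exists_walk_root v) (h7.exists_walk_root u) (by omega))
    · exact exists_walk_bridge_inr (exists_walk_trans (h7.exists_walk_root u)
        (exists_walk_symm (h7.exists_walk_root v)) (by omega))
  · obtain ⟨h, hr, hl, x, hx⟩ := hG.exists_height
    let k : V ⊕ Fin 7 → ℕ := Sum.elim (fun v => h v + 3) ![2, 1, 1, 0, 0, 0, 0]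
    have h7l : ∀ u v, rooted7.Adj u v → (![2, 1, 1, 0, 0, 0, 0] : Fin 7 → ℕ) u ≤
        (![2, 1, 1, 0, 0, 0, 0] : Fin 7 → ℕ) v + 1 := by decide
    have hk : ∀ u v, (bridge G r rooted7 0).Adj u v → k u ≤ k v + 1 := by
      rintro (u | u) (v | v) huv
      · have := hl u v huv
        simp only [k, Sum.elim_inl]
        omega
      · obtain ⟨rfl, rfl⟩ := huv
        simp [k, hr]
      · obtain ⟨rfl, rfl⟩ := huv
        simp [k]
      · exact h7l u v huv
    refine le_trans ?_ (edist_le_ediam (u := .inl x) (v := .inr 3))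
    refine le_sInf ?_
    rintro _ ⟨p, rfl⟩
    have := p.le_add_length_of_lipschitz hk
    simp only [k, Sum.elim_inl, Sum.elim_inr, hx] at this
    have h0 : (![2, 1, 1, 0, 0, 0, 0] : Fin 7 → ℕ) 3 = 0 := rfl
    rw [h0, zero_add] at this
    exact Nat.cast_le.2 this

lemma exists_isRootedCubic (q j : ℕ) (hj : j ≤ 3) :
    ∃ (V : Type) (_ : Fintype V) (G : SimpleGraph V) (r : V),
      Fintype.card V = 7 + 2 * j + 6 * q ∧ G.IsRootedCubic r (2 + j + 4 * q) := by
  induction q with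
  | zero =>
    interval_cases j
    · exact ⟨_, inferInstance, _, _, Fintype.card_fin _, isRootedCubic_rooted7⟩
    · exact ⟨_, inferInstance, _, _, Fintype.card_fin _, isRootedCubic_rooted9⟩
    · exact ⟨_, inferInstance, _, _, Fintype.card_fin _, isRootedCubic_rooted11⟩
    · exact ⟨_, inferInstance, _, _, Fintype.card_fin _, isRootedCubic_rooted13⟩
  | succ q ih =>
    obtain ⟨V, _, G, r, hV, hG⟩ := ih
    exact ⟨V ⊕ Fin 6, inferInstance, _, _, by simp [hV]; ring, hG.bridge_gadget⟩

lemma Iso.edist_le (f : G ≃g H) (u v : V) : H.edist (f u) (f v) ≤ G.edist u v := by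
  refine le_sInf ?_
  rintro _ ⟨p, rfl⟩
  have := SimpleGraph.edist_le (p.map f.toHom)
  rwa [Walk.length_map] at this

lemma Iso.ediam_le (f : G ≃g H) : H.ediam ≤ G.ediam := by
  refine ediam_le_of_edist_le fun u v => ?_
  have := (f.edist_le (f.symm u) (f.symm v)).trans edist_le_ediam
  rwa [f.apply_symm_apply, f.apply_symm_apply] at this

lemma _root_.IsKGDGraph.of_iso {k g d : ℕ} (hG : IsKGDGraph k g d G) (f : G ≃g H) :
    IsKGDGraph k g d H := by
  refine ⟨fun w => ?_, f.egirth_eq ▸ hG.2.1,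
    (le_antisymm f.ediam_le f.symm.ediam_le).trans hG.2.2⟩
  rw [← hG.1 (f.symm w), ← Set.ncard_image_of_injective _ f.symm.injective]
  congr 1
  ext v
  simp only [Set.mem_image, mem_neighborSet]
  constructor
  · rintro ⟨x, hx, rfl⟩
    exact f.symm.map_adj_iff.2 hx
  · intro h
    exact ⟨f v, by simpa using f.map_adj_iff.2 h, by simp⟩

lemma exists_isKGDGraph_three_four (q j : ℕ) (hj : j ≤ 3) :
    ∃ G : SimpleGraph (Fin (14 + 2 * j + 6 * q)), IsKGDGraph 3 4 (5 + 4 * q + j) G := by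
  obtain ⟨V, _, G, r, hV, hG⟩ := exists_isRootedCubic q j hj
  have hcard : Fintype.card (V ⊕ Fin 7) = 14 + 2 * j + 6 * q := by
    rw [Fintype.card_sum, hV, Fintype.card_fin]
    ring
  have hK := hG.isKGDGraph_bridge (by omega)
  rw [show 2 + j + 4 * q + 3 = 5 + 4 * q + j by ring] at hK
  exact ⟨_, hK.of_iso (Iso.map (Fintype.equivFinOfCardEq hcard) _)⟩

/-! ### Distance layers in cubic triangle-free graphs -/

lemma Connected.exists_dist_eq (hc : G.Connected) (x y : V) {i : ℕ} (hi : i ≤ G.dist x y) :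
    ∃ v, G.dist x v = i ∧ G.dist v y = G.dist x y - i := by
  obtain ⟨p, hp⟩ := hc.exists_walk_length_eq_dist x y
  have h₁ := dist_le (p.take i)
  have h₂ := dist_le (p.drop i)
  have h₃ := hc.dist_triangle (u := x) (v := p.getVert i) (w := y)
  rw [Walk.take_length] at h₁
  rw [Walk.drop_length] at h₂
  exact ⟨p.getVert i, by omega, by omega⟩

lemma Connected.exists_adj_dist_eq (hc : G.Connected) {x y : V} {i : ℕ}
    (hi : G.dist x y = i + 1) : ∃ v, G.dist x v = i ∧ G.Adj v y := by
  obtain ⟨v, hv, hvy⟩ := hc.exists_dist_eq x y (i := i) (by omega)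
  exact ⟨v, hv, dist_eq_one_iff_adj.1 (by omega)⟩

section cubic

variable [Fintype V]

/-- The vertices at distance `i` from `x`. -/
noncomputable def layer (G : SimpleGraph V) (x : V) (i : ℕ) : Finset V :=
  Finset.univ.filter fun v => G.dist x v = i

@[simp] lemma mem_layer {x v : V} {i : ℕ} : v ∈ G.layer x i ↔ G.dist x v = i := by
  simp [layer]

/-- The vertices at distance less than `m` from `x`. -/
noncomputable def inner (G : SimpleGraph V) (x : V) (m : ℕ) : Finset V :=
  Finset.univ.filter fun v => G.dist x v < m

@[simp] lemma mem_inner {x v : V} {m : ℕ} : v ∈ G.inner x m ↔ G.dist x v < m := by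
  simp [inner]

lemma card_inner_succ (x : V) (m : ℕ) :
    (G.inner x (m + 1)).card = (G.inner x m).card + (G.layer x m).card := by
  classical
  rw [← Finset.card_union_of_disjoint]
  · congr 1
    ext v
    simp only [mem_inner, Finset.mem_union, mem_layer]
    omega
  · rw [Finset.disjoint_left]
    intro v
    simp only [mem_inner, mem_layer]
    omega

lemma Connected.layer_card_pos (hc : G.Connected) (x y : V) {i : ℕ} (hi : i ≤ G.dist x y) :
    1 ≤ (G.layer x i).card := by
  obtain ⟨v, hv, -⟩ := hc.exists_dist_eq x y hi
  exact Finset.card_pos.2 ⟨v, mem_layer.2 hv⟩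

variable [DecidableRel G.Adj]

lemma IsRegularOfDegree.four_le_card_layers (hreg : G.IsRegularOfDegree 3) {x v : V} {i : ℕ}
    (hv : G.dist x v = i + 1) :
    4 ≤ (G.layer x i).card + (G.layer x (i + 1)).card + (G.layer x (i + 2)).card := by
  classical
  have hsub : insert v (G.neighborFinset v) ⊆
      G.layer x i ∪ G.layer x (i + 1) ∪ G.layer x (i + 2) := by
    intro w hw
    simp only [Finset.mem_union, mem_layer]
    rcases Finset.mem_insert.1 hw with rfl | hw
    · omega
    · have := ((G.mem_neighborFinset v w).1 hw).diff_dist_adj (u := x)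
      omega
  have h := Finset.card_le_card hsub
  rw [Finset.card_insert_of_notMem (by simp), G.card_neighborFinset_eq_degree, hreg v] at h
  have h₁ := Finset.card_union_le (G.layer x i ∪ G.layer x (i + 1)) (G.layer x (i + 2))
  have h₂ := Finset.card_union_le (G.layer x i) (G.layer x (i + 1))
  omega

lemma IsRegularOfDegree.not_card_layers_one_two_one (hreg : G.IsRegularOfDegree 3)
    (htri : G.TriangleFree) {x : V} {i : ℕ} (h₀ : (G.layer x i).card = 1)
    (h₁ : (G.layer x (i + 1)).card = 2) : (G.layer x (i + 2)).card ≠ 1 := by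
  classical
  intro h₂
  obtain ⟨u, hu⟩ := Finset.card_eq_one.1 h₀
  obtain ⟨a, b, hab, hl⟩ := Finset.card_eq_two.1 h₁
  obtain ⟨w, hw⟩ := Finset.card_eq_one.1 h₂
  have key : ∀ c c', G.layer x (i + 1) = {c, c'} → G.neighborFinset c = {u, c', w} := by
    intro c c' hcc
    have hc : G.dist x c = i + 1 := mem_layer.1 (hcc ▸ Finset.mem_insert_self c {c'})
    refine Finset.eq_of_subset_of_card_le ?_ ?_
    · intro z hz
      rw [mem_neighborFinset] at hz
      have hz' := hz.diff_dist_adj (u := x)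
      have hcases : z ∈ G.layer x i ∨ z ∈ G.layer x (i + 1) ∨ z ∈ G.layer x (i + 2) := by
        simp only [mem_layer]
        omega
      rw [hu, hcc, hw] at hcases
      have := hz.ne
      simp only [Finset.mem_singleton, Finset.mem_insert] at hcases ⊢
      tauto
    · rw [G.card_neighborFinset_eq_degree, hreg c]
      exact Finset.card_le_three
  have ha := key a b hl
  have hb := key b a (hl.trans (Finset.pair_comm a b))
  refine htri u a b ?_ ?_ ?_
  · rw [adj_comm, ← mem_neighborFinset, ha]
    simp
  · rw [← mem_neighborFinset, ha]
    simp
  · rw [adj_comm, ← mem_neighborFinset, hb]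
    simp

lemma IsRegularOfDegree.even_card (hreg : G.IsRegularOfDegree 3) : Even (Fintype.card V) := by
  have h := G.sum_degrees_eq_twice_card_edges
  rw [Finset.sum_congr rfl fun v _ => hreg v, Finset.sum_const, Finset.card_univ,
    smul_eq_mul] at h
  rw [Nat.even_iff]
  omega

/-- If a single edge leaves `S`, then `S` has an odd number of vertices. -/
lemma IsRegularOfDegree.odd_card_of_cut_edge (hreg : G.IsRegularOfDegree 3) (S : Finset V)
    {u v : V} (hu : u ∈ S) (hv : v ∉ S) (huv : G.Adj u v)
    (hcut : ∀ w ∈ S, ∀ z ∉ S, G.Adj w z → w = u ∧ z = v) : Odd S.card := by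
  classical
  let H : SimpleGraph V :=
    { Adj := fun a b => G.Adj a b ∧ (a ∈ S ∨ b ∈ S)
      symm := ⟨fun _ _ h => ⟨h.1.symm, h.2.symm⟩⟩
      loopless := ⟨fun _ h => h.1.ne rfl⟩ }
  have hdec : DecidableRel H.Adj := fun a b => inferInstanceAs (Decidable (_ ∧ _))
  have hdeg : ∀ w, H.degree w = (if w ∈ S then 3 else 0) + if w = v then 1 else 0 := by
    intro w
    rw [← card_neighborFinset_eq_degree]
    by_cases hw : w ∈ S
    · have hwv : w ≠ v := fun h => hv (h ▸ hw)
      rw [if_pos hw, if_neg hwv, ← hreg w, ← card_neighborFinset_eq_degree]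
      congr 1
      ext z
      simp [H, hw]
    · rw [if_neg hw]
      by_cases hwv : w = v
      · rw [if_pos hwv, zero_add, Finset.card_eq_one]
        refine ⟨u, ?_⟩
        ext z
        simp only [mem_neighborFinset, Finset.mem_singleton, H]
        constructor
        · rintro ⟨hwz, hz⟩
          exact (hcut z (hz.resolve_left hw) w hw hwz.symm).1
        · rintro rfl
          exact ⟨hwv ▸ huv.symm, .inr hu⟩
      · rw [if_neg hwv, Finset.card_eq_zero, Finset.eq_empty_iff_forall_notMem]
        intro z hz
        simp only [mem_neighborFinset, H] at hz
        exact hwv (hcut z (hz.2.resolve_left hw) w hw hz.1.symm).2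
  have h := H.sum_degrees_eq_twice_card_edges
  rw [Finset.sum_congr rfl fun w _ => hdeg w, Finset.sum_add_distrib, Finset.sum_ite_mem,
    Finset.univ_inter, Finset.sum_const, Finset.sum_ite_eq' Finset.univ v, if_pos (by simp),
    smul_eq_mul] at h
  rw [Nat.odd_iff]
  omega

lemma IsRegularOfDegree.odd_card_inner (hreg : G.IsRegularOfDegree 3) (hc : G.Connected) {x : V}
    {i : ℕ} (h₀ : (G.layer x i).card = 1) (h₁ : (G.layer x (i + 1)).card = 1) :
    Odd (G.inner x (i + 1)).card := by
  obtain ⟨u, hu⟩ := Finset.card_eq_one.1 h₀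
  obtain ⟨v, hv⟩ := Finset.card_eq_one.1 h₁
  have hu' : ∀ w, G.dist x w = i ↔ w = u := by simpa [Finset.ext_iff] using hu
  have hv' : ∀ w, G.dist x w = i + 1 ↔ w = v := by simpa [Finset.ext_iff] using hv
  have huv : G.Adj u v := by
    obtain ⟨w, hw, hwv⟩ := hc.exists_adj_dist_eq ((hv' v).2 rfl)
    rwa [← (hu' w).1 hw]
  refine hreg.odd_card_of_cut_edge _ (u := u) (v := v) ?_ ?_ huv ?_
  · rw [mem_inner, (hu' u).2 rfl]
    omega
  · rw [mem_inner, (hv' v).2 rfl]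
    omega
  · intro w hw z hz hwz
    rw [mem_inner] at hw hz
    have := hwz.diff_dist_adj (u := x)
    exact ⟨(hu' w).1 (by omega), (hv' z).1 (by omega)⟩

lemma IsRegularOfDegree.seven_le_card_inner (hreg : G.IsRegularOfDegree 3)
    (htri : G.TriangleFree) (hc : G.Connected) {y z : V} (hz : G.dist y z = 3) :
    7 ≤ (G.inner y 3).card := by
  classical
  have h0 : (G.inner y 0).card = 0 := by simp [Finset.card_eq_zero, Finset.ext_iff]
  have hl0 := hc.layer_card_pos y z (i := 0) (by omega)
  have hl1 : G.layer y 1 = G.neighborFinset y := by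
    ext v
    simp
  have hl1' : (G.layer y 1).card = 3 := by rw [hl1, card_neighborFinset_eq_degree, hreg y]
  have hl2 : 3 ≤ (G.layer y 2).card := by
    by_contra! hlt
    have key : ∀ u, G.Adj y u → (G.neighborFinset u).erase y = G.layer y 2 := by
      intro u hu
      refine Finset.eq_of_subset_of_card_le ?_ ?_
      · intro w hw
        obtain ⟨hwy, huw⟩ := Finset.mem_erase.1 hw
        rw [mem_neighborFinset] at huw
        have h₁ := huw.diff_dist_adj (u := y)
        rw [dist_eq_one_iff_adj.2 hu] at h₁
        have h₂ : G.dist y w ≠ 1 := fun h => htri y u w hu huw (dist_eq_one_iff_adj.1 h)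
        have h₃ := hc.pos_dist_of_ne (Ne.symm hwy)
        rw [mem_layer]
        omega
      · rw [Finset.card_erase_of_mem (by simpa using hu.symm), card_neighborFinset_eq_degree,
          hreg u]
        omega
    obtain ⟨w, hw, hwz⟩ := hc.exists_adj_dist_eq (i := 2) hz
    have hsub : insert z (G.neighborFinset y) ⊆ G.neighborFinset w := by
      intro u hu
      rw [mem_neighborFinset]
      rcases Finset.mem_insert.1 hu with rfl | hu
      · exact hwz
      · rw [mem_neighborFinset] at hu
        have := mem_layer.2 hw
        rw [← key u hu, Finset.mem_erase, mem_neighborFinset] at this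
        exact this.2.symm
    have hzy : z ∉ G.neighborFinset y := by
      rw [mem_neighborFinset, ← dist_eq_one_iff_adj]
      omega
    have := Finset.card_le_card hsub
    rw [Finset.card_insert_of_notMem hzy, card_neighborFinset_eq_degree,
      card_neighborFinset_eq_degree, hreg y, hreg w] at this
    omega
  have h₁ := G.card_inner_succ y 0
  have h₂ := G.card_inner_succ y 1
  have h₃ := G.card_inner_succ y 2
  simp only [Nat.reduceAdd] at h₁ h₂ h₃
  omega

end cubic

/-- The numerical consequence of the constraints on sizes `f i` of layers with partial sums
`P m`, in a cubic triangle-free graph with `n` vertices. -/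
lemma le_of_layer_constraints {d q j n : ℕ} (hj : j ≤ 3) (hd : d = 5 + 4 * q + j) (f P : ℕ → ℕ)
    (hn : Even n) (hP : ∀ m, P (m + 1) = P m + f m) (hpos : ∀ i ≤ d, 1 ≤ f i)
    (h4 : ∀ i, i + 1 ≤ d → 4 ≤ f i + f (i + 1) + f (i + 2))
    (h121 : ∀ i, f i = 1 → f (i + 1) = 2 → f (i + 2) ≠ 1)
    (hodd : ∀ i, f i = 1 → f (i + 1) = 1 → Odd (P (i + 1)))
    (hfirst : 7 ≤ P 3) (hlast : P (d - 2) + 7 ≤ n) : 14 + 2 * j + 6 * q ≤ n := by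
  rw [Nat.even_iff] at hn
  simp only [Nat.odd_iff] at hodd
  have hwindow : ∀ m, m + 4 ≤ d → P m + 6 ≤ P (m + 4) := by
    intro m hm
    have := h4 m (by omega)
    have := h4 (m + 1) (by omega)
    have := h121 m
    have := h121 (m + 1)
    have := hpos m (by omega)
    have := hpos (m + 1) (by omega)
    have := hpos (m + 2) (by omega)
    have := hpos (m + 3) (by omega)
    have := hP m
    have := hP (m + 1)
    have := hP (m + 2)
    have := hP (m + 3)
    simp only [add_assoc, Nat.reduceAdd] at *
    omega
  have hsum : ∀ t ≤ q, 7 + 6 * t ≤ P (3 + 4 * t) := by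
    intro t
    induction t with
    | zero => simpa using hfirst
    | succ t ih =>
      intro ht
      have := ih (by omega)
      have := hwindow (3 + 4 * t) (by omega)
      rw [show 3 + 4 * (t + 1) = 3 + 4 * t + 4 by ring]
      omega
  have hq := hsum q le_rfl
  have hm : d - 2 = 3 + 4 * q + j := by omega
  rw [hm] at hlast
  generalize 3 + 4 * q = m at *
  have p0 := hP m
  have p1 := hP (m + 1)
  have p2 := hP (m + 2)
  have o0 := hodd m
  have o1 := hodd (m + 1)
  have c := h121 m
  have a0 := hpos m (by omega)
  have a1 := hpos (m + 1) (by omega)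
  have a2 := hpos (m + 2) (by omega)
  have a3 := h4 m (by omega)
  simp only [add_assoc, Nat.reduceAdd] at *
  have hm0 : P (m + 0) = P m := rfl
  interval_cases j <;> omega

lemma _root_.IsKGDGraph.le_card_three_four [Fintype V] {d q j : ℕ} (hj : j ≤ 3)
    (hd : d = 5 + 4 * q + j) (hG : IsKGDGraph 3 4 d G) :
    14 + 2 * j + 6 * q ≤ Fintype.card V := by
  classical
  obtain ⟨hreg', hgirth, hdiam⟩ := hG
  have hreg : G.IsRegularOfDegree 3 := fun v => by
    rw [← hreg' v, ncard_neighborSet_eq_card_filter, ← card_neighborFinset_eq_degree,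
      neighborFinset_eq_filter]
  have htri : G.TriangleFree := triangleFree_iff_four_le_egirth.2 (by rw [hgirth]; rfl)
  have : Nontrivial V := nontrivial_of_ediam_ne_zero (G := G) (by
    rw [hdiam]
    exact_mod_cast (by omega : d ≠ 0))
  have hc : G.Connected := connected_of_ediam_ne_top (by rw [hdiam]; exact ENat.natCast_ne_top d)
  obtain ⟨x, y, hxy⟩ := G.exists_edist_eq_ediam_of_finite
  have hdxy : G.dist x y = d := by rw [dist, hxy, hdiam]; rfl
  obtain ⟨x₃, hx₃, -⟩ := hc.exists_dist_eq x y (i := 3) (by omega)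
  obtain ⟨y₃, -, hy₃⟩ := hc.exists_dist_eq x y (i := d - 3) (by omega)
  refine le_of_layer_constraints hj hd (fun i => (G.layer x i).card)
    (fun m => (G.inner x m).card) hreg.even_card (G.card_inner_succ x)
    (fun i hi => hc.layer_card_pos x y (hi.trans_eq hdxy.symm)) ?_
    (fun i => hreg.not_card_layers_one_two_one htri) (fun i => hreg.odd_card_inner hc)
    (hreg.seven_le_card_inner htri hc hx₃) ?_
  · intro i hi
    obtain ⟨v, hv, -⟩ := hc.exists_dist_eq x y (hi.trans_eq hdxy.symm)
    exact hreg.four_le_card_layers hv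
  · have h7 := hreg.seven_le_card_inner htri hc (y := y) (z := y₃) (by rw [dist_comm]; omega)
    have hdisj : Disjoint (G.inner x (d - 2)) (G.inner y 3) := by
      rw [Finset.disjoint_left]
      intro v hv hv'
      rw [mem_inner] at hv hv'
      have := hc.dist_triangle (u := x) (v := v) (w := y)
      rw [G.dist_comm (u := v)] at this
      omega
    have := Finset.card_le_univ (G.inner x (d - 2) ∪ G.inner y 3)
    rw [Finset.card_union_of_disjoint hdisj] at this
    omega

end SimpleGraph

theorem minOrder_three_four (d q j : ℕ) (hd : 5 ≤ d) (hj : j ≤ 3)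
    (hdecomp : d = 5 + 4 * q + j) :
    (∃ G : SimpleGraph (Fin (14 + 2 * j + 6 * q)), IsKGDGraph 3 4 d G) ∧
    ∀ {V : Type} [Fintype V] (G : SimpleGraph V), IsKGDGraph 3 4 d G →
      14 + 2 * j + 6 * q ≤ Fintype.card V := by
  subst hdecomp
  exact ⟨SimpleGraph.exists_isKGDGraph_three_four q j hj, fun G hG => hG.le_card_three_four hj rfl⟩
end
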